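/- arXiv:2101.00811 — 2 statements merged into one kernel-verified Lean document; each statement's English description precedes it below -/
import Mathlib

section
/- Let K be an imaginary quadratic number field of class number one. Let Q ≥ 16, 0 < δ < 1 and N = Q^{1+δ}/16. Then Σ_{p prime in 𝓞_K, N(p) ≤ Q} Σ_{a mod p, (a,p)=1} |Σ_{n ∈ 𝓞_K, N(n) ≤ N} a_n · ẽ_K(na/p)|² ≪ (1/(1−δ)) · (Q² log log Q / log Q) · Σ_{n ∈ 𝓞_K, N(n) ≤ N} |a_n|², where p runs over the primes in 𝓞_K and (a_n) is any sequence of complex numbers. -/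
open NumberField

/-- The additive character ẽ_K(z) = exp(2πi(z/√D_K - z̄/√D_K)), where D_K is the
discriminant of K and √D_K = i·√(-D_K) is a fixed square root (D_K < 0 for K imaginary
quadratic). -/
noncomputable def eK (K : Type) [Field K] [NumberField K] (z : ℂ) : ℂ :=
  Complex.exp (2 * (Real.pi : ℂ) * Complex.I *
    (z / (Complex.I * Real.sqrt (-(NumberField.discr K : ℝ))) -
      (starRingEnd ℂ) z / (Complex.I * Real.sqrt (-(NumberField.discr K : ℝ)))))

/-- A ring `O` embedded in `ℂ` as a lattice `ℤ + ℤω`, with the index of a principal ideal given by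
the square of the absolute value. -/
structure LatticeRing (O : Type) [CommRing O] where
  τ : O →+* ℂ
  ω : O
  im_pos : 0 < (τ ω).im
  repr : ∀ n : O, ∃ u v : ℤ, n = u + v * ω
  card_quot : ∀ q : O, q ≠ 0 → (Nat.card (O ⧸ Ideal.span {q}) : ℝ) = ‖τ q‖ ^ 2

namespace LatticeRing

variable {O : Type} [CommRing O] (D : LatticeRing O)

/-- The additive character of `ℂ` whose annihilator lattice is `O`. -/
noncomputable def ψ (z : ℂ) : ℂ :=
  Complex.exp (2 * Real.pi * Complex.I * ((z.im / (D.τ D.ω).im : ℝ) : ℂ))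

lemma ψ_add (z w : ℂ) : D.ψ (z + w) = D.ψ z * D.ψ w := by
  simp only [ψ]
  rw [← Complex.exp_add]
  congr 1
  rw [Complex.add_im, add_div]
  push_cast
  ring

lemma ψ_zero : D.ψ 0 = 1 := by simp [ψ]

lemma norm_ψ (z : ℂ) : ‖D.ψ z‖ = 1 := by
  rw [ψ, mul_assoc, mul_comm Complex.I, ← mul_assoc]
  have : (2 * (Real.pi : ℂ) * ((z.im / (D.τ D.ω).im : ℝ) : ℂ)) =
    ((2 * Real.pi * (z.im / (D.τ D.ω).im) : ℝ) : ℂ) := by push_cast; ring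
  rw [this, Complex.norm_exp_ofReal_mul_I]

lemma ψ_sub (z w : ℂ) : D.ψ (z - w) = D.ψ z * starRingEnd ℂ (D.ψ w) := by
  have h : D.ψ (z - w) * D.ψ w = D.ψ z := by rw [← ψ_add]; simp
  have h2 : D.ψ w * starRingEnd ℂ (D.ψ w) = 1 := by
    rw [Complex.mul_conj, Complex.normSq_eq_norm_sq, norm_ψ]; simp
  rw [← h, mul_assoc, h2, mul_one]

lemma ψ_sum {ι : Type*} (s : Finset ι) (f : ι → ℂ) :
    D.ψ (∑ i ∈ s, f i) = ∏ i ∈ s, D.ψ (f i) := by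
  classical
  induction s using Finset.induction_on with
  | empty => simp [ψ_zero]
  | insert a s ha ih => rw [Finset.sum_insert ha, Finset.prod_insert ha, ψ_add, ih]

lemma τ_coord (u v : ℤ) : D.τ (u + v * D.ω) = u + v * D.τ D.ω := by simp

lemma ψ_τ (n : O) : D.ψ (D.τ n) = 1 := by
  obtain ⟨u, v, rfl⟩ := D.repr n
  rw [ψ, Complex.exp_eq_one_iff]
  refine ⟨v, ?_⟩
  have := D.im_pos.ne'
  simp [this]
  ring

lemma exists_im_of_ψ_eq_one {z : ℂ} (h : D.ψ z = 1) : ∃ v : ℤ, z.im = v * (D.τ D.ω).im := by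
  rw [ψ, Complex.exp_eq_one_iff] at h
  obtain ⟨v, hv⟩ := h
  refine ⟨v, ?_⟩
  have h2 : (2 * (Real.pi : ℂ) * Complex.I) ≠ 0 := Complex.two_pi_I_ne_zero
  have h3 : ((z.im / (D.τ D.ω).im : ℝ) : ℂ) = v := by
    apply mul_left_cancel₀ h2; rw [hv]; ring
  have h4 : (z.im / (D.τ D.ω).im : ℝ) = v := by exact_mod_cast h3
  rw [← h4, div_mul_cancel₀ _ D.im_pos.ne']

lemma exists_trace : ∃ f : ℤ, 2 * (D.τ D.ω).re = f := by
  obtain ⟨e, f, h⟩ := D.repr (D.ω * D.ω)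
  have h2 := congrArg (fun x => (D.τ x).im) h
  simp at h2
  refine ⟨f, ?_⟩
  have := D.im_pos.ne'
  apply mul_right_cancel₀ this
  linarith

lemma τ_injective : Function.Injective D.τ := by
  rw [injective_iff_map_eq_zero]
  intro n hn
  obtain ⟨u, v, rfl⟩ := D.repr n
  rw [τ_coord] at hn
  have h1 := congrArg Complex.im hn
  simp [D.im_pos.ne'] at h1
  subst h1
  simp at hn
  simp [hn]

lemma τ_ne_zero {n : O} (h : n ≠ 0) : D.τ n ≠ 0 := by
  rwa [Ne, map_eq_zero_iff _ D.τ_injective]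

lemma norm_τ_pos {n : O} (h : n ≠ 0) : 0 < ‖D.τ n‖ := norm_pos_iff.2 (D.τ_ne_zero h)

lemma dvd_of_ψ {q n : O} (hq : q ≠ 0) (h : ∀ m : O, D.ψ (D.τ m * (D.τ n / D.τ q)) = 1) :
    q ∣ n := by
  set x := D.τ n / D.τ q with hx
  obtain ⟨v, hv⟩ := D.exists_im_of_ψ_eq_one (by simpa using h 1)
  obtain ⟨u, hu⟩ := D.exists_im_of_ψ_eq_one (h D.ω)
  obtain ⟨f, hf⟩ := D.exists_trace
  have hxt : x = D.τ (((u - v * f : ℤ) : O) + v * D.ω) := by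
    rw [τ_coord]
    apply Complex.ext
    · have := D.im_pos.ne'
      rw [Complex.mul_im, hv] at hu
      simp
      rw [← hf]
      apply mul_right_cancel₀ this
      linear_combination hu
    · simp [hv]
  refine ⟨_, D.τ_injective (a₂ := q * (((u - v * f : ℤ) : O) + v * D.ω)) ?_⟩
  rw [map_mul, ← hxt, hx, mul_div_cancel₀ _ (D.τ_ne_zero hq)]

lemma one_le_norm_τ {n : O} (h : n ≠ 0) : 1 ≤ ‖D.τ n‖ := by
  have h1 := D.card_quot n h
  have h2 := D.norm_τ_pos h
  have h3 : 0 < Nat.card (O ⧸ Ideal.span {n}) := by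
    by_contra! h4
    have h5 : Nat.card (O ⧸ Ideal.span {n}) = 0 := by omega
    rw [h5] at h1
    have := pow_pos h2 2
    simp at h1
    linarith
  have h6 : (1 : ℝ) ≤ ‖D.τ n‖ ^ 2 := by rw [← h1]; exact_mod_cast h3
  nlinarith

lemma two_le_of_prime {p : O} (h : Prime p) : 2 ≤ ‖D.τ p‖ ^ 2 := by
  have h1 := D.card_quot p h.ne_zero
  have h2 := D.one_le_norm_τ h.ne_zero
  have h3 : Nat.card (O ⧸ Ideal.span {p}) ≠ 1 := by
    intro h4
    have h5 := (Nat.card_eq_one_iff_unique.1 h4).1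
    rw [Ideal.Quotient.subsingleton_iff, Ideal.span_singleton_eq_top] at h5
    exact h.not_isUnit h5
  have h4 : Nat.card (O ⧸ Ideal.span {p}) ≠ 0 := by
    intro h4
    rw [h4] at h1
    norm_num at h1
    nlinarith
  rw [← h1]
  exact_mod_cast (by omega : 2 ≤ Nat.card (O ⧸ Ideal.span {p}))

lemma finite_quot (D : LatticeRing O) {q : O} (hq : q ≠ 0) : Finite (O ⧸ Ideal.span {q}) := by
  have h1 := D.card_quot q hq
  have h2 := D.norm_τ_pos hq
  apply Nat.finite_of_card_ne_zero
  intro h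
  rw [h] at h1
  have := pow_pos h2 2
  simp at h1
  linarith

/-- A bound for the diameter of the fundamental parallelogram. -/
noncomputable def W : ℝ := 1 + ‖D.τ D.ω‖

lemma one_le_W : 1 ≤ D.W := by
  have := norm_nonneg (D.τ D.ω)
  unfold W; linarith

lemma norm_coord_le (x y : ℝ) {B : ℝ} (hx : |x| ≤ B) (hy : |y| ≤ B) :
    ‖(x : ℂ) + y * D.τ D.ω‖ ≤ B * D.W := by
  calc ‖(x : ℂ) + y * D.τ D.ω‖ ≤ ‖(x : ℂ)‖ + ‖(y : ℂ) * D.τ D.ω‖ := norm_add_le _ _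
    _ = |x| + |y| * ‖D.τ D.ω‖ := by rw [norm_mul]; simp
    _ ≤ B + B * ‖D.τ D.ω‖ := by gcongr
    _ = B * D.W := by unfold W; ring

lemma exists_real_coord (z : ℂ) : ∃ x y : ℝ, z = x + y * D.τ D.ω := by
  refine ⟨z.re - z.im / (D.τ D.ω).im * (D.τ D.ω).re, z.im / (D.τ D.ω).im, ?_⟩
  have := D.im_pos.ne'
  apply Complex.ext
  · simp
  · simp [this]

lemma exists_near (z : ℂ) : ∃ n : O, ‖z - D.τ n‖ ≤ D.W := by
  obtain ⟨x, y, rfl⟩ := D.exists_real_coord z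
  refine ⟨(⌊x⌋ : ℤ) + (⌊y⌋ : ℤ) * D.ω, ?_⟩
  rw [τ_coord]
  have := D.norm_coord_le (Int.fract x) (Int.fract y) (B := 1)
    (by rw [abs_of_nonneg (Int.fract_nonneg _)]; exact (Int.fract_lt_one _).le)
    (by rw [abs_of_nonneg (Int.fract_nonneg _)]; exact (Int.fract_lt_one _).le)
  rw [one_mul] at this
  convert this using 2
  rw [← Int.self_sub_floor, ← Int.self_sub_floor]
  push_cast
  ring

/-- A constant with which the coordinates are bounded by the absolute value. -/
noncomputable def A : ℝ := 1 + D.W / (D.τ D.ω).im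

lemma one_le_A : 1 ≤ D.A := by
  have := D.one_le_W
  have h := D.im_pos
  unfold A
  have : 0 ≤ D.W / (D.τ D.ω).im := by positivity
  linarith

lemma abs_coord_le (u v : ℤ) : |(u : ℝ)| ≤ D.A * ‖D.τ (u + v * D.ω)‖ ∧
    |(v : ℝ)| ≤ D.A * ‖D.τ (u + v * D.ω)‖ := by
  rw [τ_coord]
  set z := (u : ℂ) + v * D.τ D.ω with hz
  have hy := D.im_pos
  have h1 : |(v : ℝ)| * (D.τ D.ω).im ≤ ‖z‖ := by
    have := Complex.abs_im_le_norm z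
    rw [hz] at this ⊢
    simp only [Complex.add_im, Complex.intCast_im, Complex.mul_im, Complex.intCast_re, zero_add,
      zero_mul, add_zero, abs_mul, abs_of_pos hy] at this
    exact this
  have h2 : |(v : ℝ)| ≤ ‖z‖ / (D.τ D.ω).im := by rwa [le_div_iff₀ hy]
  have h3 : |(u : ℝ)| ≤ ‖z‖ + |(v : ℝ)| * ‖D.τ D.ω‖ := by
    calc |(u : ℝ)| = ‖z - v * D.τ D.ω‖ := by
          rw [hz]; simp
      _ ≤ ‖z‖ + ‖(v : ℂ) * D.τ D.ω‖ := norm_sub_le _ _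
      _ = _ := by rw [norm_mul]; simp
  have hW : ‖D.τ D.ω‖ ≤ D.W := by unfold W; linarith
  have e : D.A * ‖z‖ = ‖z‖ + ‖z‖ / (D.τ D.ω).im * D.W := by unfold A; ring
  rw [e]
  constructor
  · refine h3.trans ?_
    gcongr
  · have h5 := D.one_le_W
    have h6 : 0 ≤ ‖z‖ / (D.τ D.ω).im := by positivity
    nlinarith [norm_nonneg z]

lemma card_le_of_norm_sub_le (s : Finset O) (T : ℝ) (n₀ : O)
    (h : ∀ n ∈ s, ‖D.τ n - D.τ n₀‖ ≤ T) : (s.card : ℝ) ≤ (2 * D.A * T + 1) ^ 2 := by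
  classical
  rcases s.eq_empty_or_nonempty with rfl | ⟨n₁, hn₁⟩
  · simp; positivity
  have hT : 0 ≤ T := (norm_nonneg _).trans (h n₁ hn₁)
  have hA := D.one_le_A
  set L : ℤ := ⌊D.A * T⌋ with hL
  have hL0 : 0 ≤ L := Int.floor_nonneg.2 (by positivity)
  have hsub : s ⊆ ((Finset.Icc (-L) L) ×ˢ (Finset.Icc (-L) L)).image
      (fun p : ℤ × ℤ => n₀ + (p.1 + p.2 * D.ω)) := by
    intro n hn
    obtain ⟨u, v, huv⟩ := D.repr (n - n₀)
    have h1 := h n hn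
    rw [← map_sub, huv] at h1
    obtain ⟨h2, h3⟩ := D.abs_coord_le u v
    have h4 : D.A * ‖D.τ (u + v * D.ω)‖ ≤ D.A * T := by gcongr
    have hu : |u| ≤ L := Int.le_floor.2 (by push_cast; linarith)
    have hv : |v| ≤ L := Int.le_floor.2 (by push_cast; linarith)
    refine Finset.mem_image.2 ⟨(u, v), ?_, ?_⟩
    · simp [abs_le.1 hu, abs_le.1 hv]
    · simp [← huv]
  have hc := (Finset.card_le_card hsub).trans Finset.card_image_le
  rw [Finset.card_product, Int.card_Icc] at hc
  have h5 : ((L + 1 - -L).toNat : ℝ) ≤ 2 * D.A * T + 1 := by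
    have : (((L + 1 - -L).toNat : ℤ) : ℝ) = 2 * L + 1 := by
      rw [Int.toNat_of_nonneg (by omega)]; push_cast; ring
    have h6 : (L : ℝ) ≤ D.A * T := Int.floor_le _
    have h7 : (((L + 1 - -L).toNat : ℤ) : ℝ) = ((L + 1 - -L).toNat : ℝ) := by norm_cast
    rw [← h7, this]
    linarith
  calc (s.card : ℝ) ≤ ((L + 1 - -L).toNat : ℝ) * ((L + 1 - -L).toNat : ℝ) := by exact_mod_cast hc
    _ ≤ (2 * D.A * T + 1) * (2 * D.A * T + 1) := by gcongr
    _ = _ := by ring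

lemma finite_norm_le (T : ℝ) : {n : O | ‖D.τ n‖ ≤ T}.Finite := by
  by_contra hinf
  obtain ⟨s, hs, hc⟩ := Set.Infinite.exists_subset_card_eq hinf (⌊(2 * D.A * T + 1) ^ 2⌋₊ + 1)
  have h1 := D.card_le_of_norm_sub_le s T 0 (fun n hn => by simpa using hs hn)
  rw [hc] at h1
  push_cast at h1
  have := Nat.lt_floor_add_one ((2 * D.A * T + 1) ^ 2)
  linarith

lemma sum_ψ_quot {q : O} (hq : q ≠ 0) [Fintype (O ⧸ Ideal.span {q})] {n : O} (hn : ¬ q ∣ n) :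
    ∑ x : O ⧸ Ideal.span {q}, D.ψ (D.τ (Quotient.out x) * (D.τ n / D.τ q)) = 0 := by
  have hper : ∀ a b : O, q ∣ a - b →
      D.ψ (D.τ a * (D.τ n / D.τ q)) = D.ψ (D.τ b * (D.τ n / D.τ q)) := by
    rintro a b ⟨c, hc⟩
    have : D.τ a * (D.τ n / D.τ q) = D.τ b * (D.τ n / D.τ q) + D.τ (c * n) := by
      have e : a = b + q * c := by rw [← hc]; ring
      rw [e]
      have := D.τ_ne_zero hq
      simp only [map_add, map_mul]
      field_simp
    rw [this, ψ_add, ψ_τ, mul_one]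
  have hout : ∀ a : O, q ∣ Quotient.out (Ideal.Quotient.mk (Ideal.span {q}) a) - a := by
    intro a
    rw [← Ideal.mem_span_singleton, ← Ideal.Quotient.eq]
    exact Quotient.out_eq _
  have hmk : ∀ x : O ⧸ Ideal.span {q}, Ideal.Quotient.mk (Ideal.span {q}) (Quotient.out x) = x :=
    fun x => Quotient.out_eq x
  have hex : ∃ m : O, D.ψ (D.τ m * (D.τ n / D.τ q)) ≠ 1 := by
    by_contra! h
    exact hn (D.dvd_of_ψ hq h)
  obtain ⟨m, hm⟩ := hex
  set F : O ⧸ Ideal.span {q} → ℂ := fun x => D.ψ (D.τ (Quotient.out x) * (D.τ n / D.τ q)) with hF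
  have h1 : ∀ x, F (x + Ideal.Quotient.mk _ m) = F x * D.ψ (D.τ m * (D.τ n / D.τ q)) := by
    intro x
    have h2 : F (x + Ideal.Quotient.mk _ m) =
        D.ψ (D.τ (Quotient.out x + m) * (D.τ n / D.τ q)) := by
      apply hper
      have h3 := hout (Quotient.out x + m)
      rwa [map_add, hmk] at h3
    rw [h2, map_add, add_mul, ψ_add]
  have h2 : ∑ x, F (x + Ideal.Quotient.mk _ m) = ∑ x, F x :=
    Equiv.sum_comp (Equiv.addRight (Ideal.Quotient.mk (Ideal.span {q}) m)) F
  simp only [h1] at h2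
  rw [← Finset.sum_mul] at h2
  have h3 : (∑ x, F x) * (D.ψ (D.τ m * (D.τ n / D.τ q)) - 1) = 0 := by
    rw [mul_sub, h2]; ring
  rcases mul_eq_zero.1 h3 with h | h
  · exact h
  · exact absurd (sub_eq_zero.1 h) hm

end LatticeRing

/-- Multiplying the kernel of a quadratic mean value inequality by `exp (lam n * mu i)` costs a
bounded factor. -/
lemma sum_norm_sq_mul_exp_le {ι β : Type} (s : Finset ι) (A : Finset β) (g : ι → β → ℂ) {E : ℝ}
    (hE0 : 0 ≤ E)
    (hE : ∀ a : β → ℂ, ∑ i ∈ s, ‖∑ n ∈ A, a n * g i n‖ ^ 2 ≤ E * ∑ n ∈ A, ‖a n‖ ^ 2)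
    (lam : β → ℂ) (mu : ι → ℂ) {R : ℝ} (hR : 0 ≤ R) (hlam : ∀ n ∈ A, ‖lam n‖ ≤ R)
    (hmu : ∀ i ∈ s, ‖mu i‖ ≤ 1) (a : β → ℂ) :
    ∑ i ∈ s, ‖∑ n ∈ A, a n * (g i n * Complex.exp (lam n * mu i))‖ ^ 2 ≤
      E * Real.exp R ^ 2 * ∑ n ∈ A, ‖a n‖ ^ 2 := by
  set S := ∑ n ∈ A, ‖a n‖ ^ 2 with hS
  have hS0 : 0 ≤ S := Finset.sum_nonneg fun _ _ => sq_nonneg _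
  let v : ℕ → EuclideanSpace ℂ s := fun k =>
    WithLp.toLp 2 fun i => ∑ n ∈ A, a n * (g i n * ((lam n * mu i) ^ k / k.factorial))
  let V : EuclideanSpace ℂ s :=
    WithLp.toLp 2 fun i => ∑ n ∈ A, a n * (g i n * Complex.exp (lam n * mu i))
  have hsum : HasSum v V := by
    have : HasSum (fun k => (EuclideanSpace.equiv s ℂ) (v k)) (EuclideanSpace.equiv s ℂ V) := by
      rw [Pi.hasSum]
      intro i
      apply hasSum_sum
      intro n _
      apply HasSum.mul_left
      apply HasSum.mul_left
      rw [Complex.exp_eq_exp_ℂ]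
      exact NormedSpace.expSeries_div_hasSum_exp _
    exact ((EuclideanSpace.equiv s ℂ).hasSum).1 this
  have hnorm : ∀ w : EuclideanSpace ℂ s, ‖w‖ = √(∑ i : s, ‖w i‖ ^ 2) :=
    fun w => EuclideanSpace.norm_eq w
  have hv : ∀ k, ‖v k‖ ≤ √(E * S) * (R ^ k / k.factorial) := by
    intro k
    rw [hnorm]
    apply Real.sqrt_le_iff.2 ⟨by positivity, ?_⟩
    rw [mul_pow, Real.sq_sqrt (by positivity)]
    have e : ∀ i : s, ‖v k i‖ ^ 2 ≤
        (1 / (k.factorial : ℝ)) ^ 2 * ‖∑ n ∈ A, (a n * lam n ^ k) * g i n‖ ^ 2 := by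
      intro i
      rw [← mul_pow]
      gcongr
      have : v k i = (mu i ^ k / k.factorial) * ∑ n ∈ A, (a n * lam n ^ k) * g i n := by
        rw [Finset.mul_sum]
        apply Finset.sum_congr rfl
        intro n _
        rw [mul_pow]; ring
      rw [this, norm_mul, norm_div, norm_pow]
      have h1 := hmu i i.2
      simp only [Complex.norm_natCast]
      gcongr
      exact pow_le_one₀ (norm_nonneg _) h1
    calc ∑ i : s, ‖v k i‖ ^ 2
        ≤ ∑ i : s, (1 / (k.factorial : ℝ)) ^ 2 * ‖∑ n ∈ A, (a n * lam n ^ k) * g i n‖ ^ 2 :=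
          Finset.sum_le_sum fun i _ => e i
      _ = (1 / (k.factorial : ℝ)) ^ 2 * ∑ i ∈ s, ‖∑ n ∈ A, (a n * lam n ^ k) * g i n‖ ^ 2 := by
          rw [← Finset.mul_sum, Finset.sum_coe_sort s
            (fun i => ‖∑ n ∈ A, (a n * lam n ^ k) * g i n‖ ^ 2)]
      _ ≤ (1 / (k.factorial : ℝ)) ^ 2 * (E * ∑ n ∈ A, ‖a n * lam n ^ k‖ ^ 2) := by
          gcongr; exact hE _
      _ ≤ (1 / (k.factorial : ℝ)) ^ 2 * (E * ((R ^ k) ^ 2 * S)) := by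
          gcongr
          rw [hS, Finset.mul_sum]
          apply Finset.sum_le_sum
          intro n hn
          rw [norm_mul, mul_pow, mul_comm, norm_pow]
          gcongr
          exact hlam n hn
      _ = E * S * (R ^ k / k.factorial) ^ 2 := by ring
  have hsum2 : HasSum (fun k => √(E * S) * (R ^ k / k.factorial)) (√(E * S) * Real.exp R) := by
    apply HasSum.mul_left
    rw [Real.exp_eq_exp_ℝ]
    exact NormedSpace.expSeries_div_hasSum_exp _
  have h := hsum.norm_le_of_bounded hsum2 hv
  have h2 : ‖V‖ ^ 2 ≤ (√(E * S) * Real.exp R) ^ 2 := by gcongr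
  rw [hnorm, Real.sq_sqrt (Finset.sum_nonneg fun _ _ => sq_nonneg _), mul_pow,
    Real.sq_sqrt (by positivity)] at h2
  calc _ = ∑ i : s, ‖V i‖ ^ 2 := by
        rw [← Finset.sum_coe_sort s]
    _ ≤ E * S * Real.exp R ^ 2 := h2
    _ = _ := by ring

namespace LatticeRing

variable {O : Type} [CommRing O] (D : LatticeRing O)

lemma sum_norm_sq_quot {q : O} (hq : q ≠ 0) [Fintype (O ⧸ Ideal.span {q})] (A : Finset O)
    (n₀ : O) (hA : ∀ n ∈ A, ∀ n' ∈ A, q ∣ n - n' → n = n') (b : O → ℂ) :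
    ∑ x : O ⧸ Ideal.span {q},
      ‖∑ n ∈ A, b n * D.ψ (D.τ (Quotient.out x) * (D.τ (n - n₀) / D.τ q))‖ ^ 2 =
      ‖D.τ q‖ ^ 2 * ∑ n ∈ A, ‖b n‖ ^ 2 := by
  classical
  have key : ∀ n ∈ A, ∀ n' ∈ A, ∑ x : O ⧸ Ideal.span {q},
      D.ψ (D.τ (Quotient.out x) * (D.τ (n - n₀) / D.τ q)) *
        starRingEnd ℂ (D.ψ (D.τ (Quotient.out x) * (D.τ (n' - n₀) / D.τ q))) =
      if n = n' then ((‖D.τ q‖ ^ 2 : ℝ) : ℂ) else 0 := by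
    intro n hn n' hn'
    have e : ∀ x : O ⧸ Ideal.span {q}, D.ψ (D.τ (Quotient.out x) * (D.τ (n - n₀) / D.τ q)) *
        starRingEnd ℂ (D.ψ (D.τ (Quotient.out x) * (D.τ (n' - n₀) / D.τ q))) =
        D.ψ (D.τ (Quotient.out x) * (D.τ (n - n') / D.τ q)) := by
      intro x
      rw [← ψ_sub]
      congr 1
      simp only [map_sub]
      ring
    simp only [e]
    split_ifs with h
    · subst h
      simp only [sub_self, map_zero, zero_div, mul_zero, ψ_zero]
      rw [← D.card_quot q hq, Nat.card_eq_fintype_card]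
      simp
    · exact D.sum_ψ_quot hq (fun hd => h (hA n hn n' hn' hd))
  have : ((∑ x : O ⧸ Ideal.span {q},
      ‖∑ n ∈ A, b n * D.ψ (D.τ (Quotient.out x) * (D.τ (n - n₀) / D.τ q))‖ ^ 2 : ℝ) : ℂ) =
      ((‖D.τ q‖ ^ 2 * ∑ n ∈ A, ‖b n‖ ^ 2 : ℝ) : ℂ) := by
    have hz : ∀ z : ℂ, ((‖z‖ ^ 2 : ℝ) : ℂ) = z * starRingEnd ℂ z := by
      intro z; rw [Complex.mul_conj, Complex.normSq_eq_norm_sq]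
    rw [Complex.ofReal_sum]
    simp only [hz, map_sum, map_mul, Finset.sum_mul_sum]
    rw [Finset.sum_comm]
    simp_rw [Finset.sum_comm (s := Finset.univ)]
    have : ∀ n ∈ A, ∀ n' ∈ A, ∑ x : O ⧸ Ideal.span {q},
        b n * D.ψ (D.τ (Quotient.out x) * (D.τ (n - n₀) / D.τ q)) * ((starRingEnd ℂ) (b n') *
        starRingEnd ℂ (D.ψ (D.τ (Quotient.out x) * (D.τ (n' - n₀) / D.τ q)))) =
        if n = n' then ((‖D.τ q‖ ^ 2 : ℝ) : ℂ) * (b n * (starRingEnd ℂ) (b n)) else 0 := by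
      intro n hn n' hn'
      have h1 := key n hn n' hn'
      calc _ = b n * (starRingEnd ℂ) (b n') * ∑ x : O ⧸ Ideal.span {q},
          D.ψ (D.τ (Quotient.out x) * (D.τ (n - n₀) / D.τ q)) *
          starRingEnd ℂ (D.ψ (D.τ (Quotient.out x) * (D.τ (n' - n₀) / D.τ q))) := by
            rw [Finset.mul_sum]; apply Finset.sum_congr rfl; intro x _; ring
        _ = _ := by
          rw [h1]
          split_ifs with h
          · subst h; ring
          · ring
    rw [Finset.sum_congr rfl fun n hn => Finset.sum_congr rfl fun n' hn' => this n hn n' hn']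
    rw [Complex.ofReal_mul, Complex.ofReal_sum, Finset.mul_sum]
    apply Finset.sum_congr rfl
    intro n hn
    rw [Finset.sum_ite_eq, if_pos hn, hz, hz]
  exact_mod_cast this

theorem large_sieve : ∃ C : ℝ, 0 < C ∧ ∀ (T κ M : ℝ), 1 ≤ T → 0 < κ → 0 ≤ M →
    ∀ (ι : Type) (s : Finset ι) (x : ι → ℂ),
    (∀ α : ℂ, ∀ s' ⊆ s, (∀ i ∈ s', ∃ o : O, ‖x i - α - D.τ o‖ ≤ κ) → (s'.card : ℝ) ≤ M) →
    ∀ (A : Finset O) (n₀ : O), (∀ n ∈ A, ‖D.τ n - D.τ n₀‖ ≤ T) → ∀ a : O → ℂ,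
    ∑ i ∈ s, ‖∑ n ∈ A, a n * D.ψ (D.τ n * x i)‖ ^ 2 ≤
      C * M * (T + 1 / κ) ^ 2 * ∑ n ∈ A, ‖a n‖ ^ 2 := by
  classical
  set y := (D.τ D.ω).im with hy
  have hy0 : 0 < y := D.im_pos
  have hW := D.one_le_W
  set R := Real.pi * D.W / y with hR
  have hR0 : 0 ≤ R := by positivity
  refine ⟨(4 + D.W) ^ 2 * (Real.exp R ^ 2 * Real.exp R ^ 2), by positivity, ?_⟩
  intro T κ M hT hκ hM0 ι s x hM A n₀ hA a
  obtain ⟨H, hH1, hH2⟩ : ∃ H : ℕ, 2 * T + D.W / κ + 1 ≤ H ∧ (H : ℝ) ≤ 2 * T + D.W / κ + 2 := by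
    refine ⟨⌈2 * T + D.W / κ + 1⌉₊, Nat.le_ceil _, ?_⟩
    have := Nat.ceil_lt_add_one (a := 2 * T + D.W / κ + 1) (by positivity)
    linarith
  have hWκ : 0 < D.W / κ := by positivity
  have hHpos : (0 : ℝ) < H := by linarith
  set q : O := (H : O) with hq
  have hτq : D.τ q = (H : ℂ) := by simp [hq]
  have hq0 : q ≠ 0 := by
    intro h
    rw [h, map_zero] at hτq
    have : (H : ℂ) ≠ 0 := by exact_mod_cast hHpos.ne'
    exact this hτq.symm
  have := D.finite_quot hq0
  let _ := Fintype.ofFinite (O ⧸ Ideal.span {q})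
  have hHC : (H : ℂ) ≠ 0 := by exact_mod_cast hHpos.ne'
  choose m hm using fun i => D.exists_near (H * x i)
  set η : ι → ℂ := fun i => H * x i - D.τ (m i) with hη
  -- the values at the grid points
  set F : O ⧸ Ideal.span {q} → (O → ℂ) → ℝ := fun c b =>
    ‖∑ n ∈ A, b n * D.ψ (D.τ (Quotient.out c) * (D.τ (n - n₀) / D.τ q))‖ ^ 2 with hF
  have hper : ∀ i, ∃ o : O,
      m i = Quotient.out (Ideal.Quotient.mk (Ideal.span {q}) (m i)) + q * o := by
    intro i
    have h1 : q ∣ m i - Quotient.out (Ideal.Quotient.mk (Ideal.span {q}) (m i)) := by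
      rw [← Ideal.mem_span_singleton, ← Ideal.Quotient.eq]
      exact (Quotient.out_eq _).symm
    obtain ⟨o, ho⟩ := h1
    exact ⟨o, by rw [← ho]; ring⟩
  have hgrid : ∀ b : O → ℂ, ∑ i ∈ s, ‖∑ n ∈ A, b n * D.ψ (D.τ (n - n₀) * (D.τ (m i) / H))‖ ^ 2 ≤
      (M * H ^ 2) * ∑ n ∈ A, ‖b n‖ ^ 2 := by
    intro b
    have e1 : ∀ i ∈ s, ‖∑ n ∈ A, b n * D.ψ (D.τ (n - n₀) * (D.τ (m i) / H))‖ ^ 2 =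
        F (Ideal.Quotient.mk _ (m i)) b := by
      intro i _
      obtain ⟨o, ho⟩ := hper i
      simp only [hF]
      congr 2
      apply Finset.sum_congr rfl
      intro n _
      congr 1
      conv_lhs => rw [ho]
      have : D.τ (n - n₀) * (D.τ (Quotient.out (Ideal.Quotient.mk (Ideal.span {q}) (m i)) + q * o)
          / H) = D.τ (Quotient.out (Ideal.Quotient.mk (Ideal.span {q}) (m i))) *
          (D.τ (n - n₀) / D.τ q) + D.τ ((n - n₀) * o) := by
        rw [map_add, map_mul, map_mul, hτq]
        field_simp
      rw [this, ψ_add, ψ_τ, mul_one]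
    rw [Finset.sum_congr rfl e1]
    rw [← Finset.sum_fiberwise s (fun i => Ideal.Quotient.mk (Ideal.span {q}) (m i))]
    have e2 : ∀ c : O ⧸ Ideal.span {q},
        ∑ i ∈ s with Ideal.Quotient.mk (Ideal.span {q}) (m i) = c,
          F (Ideal.Quotient.mk _ (m i)) b ≤ M * F c b := by
      intro c
      rw [Finset.sum_congr rfl (g := fun _ => F c b)
        (fun i hi => by rw [(Finset.mem_filter.1 hi).2])]
      rw [Finset.sum_const, nsmul_eq_mul]
      have hFc : 0 ≤ F c b := sq_nonneg _
      gcongr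
      apply hM (D.τ (Quotient.out c) / H) _ (Finset.filter_subset _ _)
      intro i hi
      have hc := (Finset.mem_filter.1 hi).2
      obtain ⟨o, ho⟩ := hper i
      rw [hc] at ho
      refine ⟨o, ?_⟩
      have e3 : x i - D.τ (Quotient.out c) / H - D.τ o = (H * x i - D.τ (m i)) / H := by
        rw [ho, map_add, map_mul, hτq]
        field_simp
        ring
      rw [e3, norm_div, Complex.norm_natCast, div_le_iff₀ hHpos]
      refine (hm i).trans ?_
      have : D.W = κ * (D.W / κ) := by field_simp
      rw [this]
      gcongr
      linarith
    refine (Finset.sum_le_sum fun c _ => e2 c).trans ?_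
    rw [← Finset.mul_sum, mul_assoc]
    gcongr
    apply le_of_eq
    rw [D.sum_norm_sq_quot hq0 A n₀ _ b, hτq, Complex.norm_natCast]
    rintro n hn n' hn' ⟨d, hd⟩
    by_contra hne
    have hd0 : d ≠ 0 := by
      rintro rfl
      rw [mul_zero] at hd
      exact hne (sub_eq_zero.1 hd)
    have h1 := D.one_le_norm_τ hd0
    have h2 : ‖D.τ n - D.τ n'‖ = H * ‖D.τ d‖ := by
      rw [← map_sub, hd, map_mul, hτq, norm_mul, Complex.norm_natCast]
    have h3 : ‖D.τ n - D.τ n'‖ ≤ 2 * T := by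
      calc ‖D.τ n - D.τ n'‖ = ‖(D.τ n - D.τ n₀) - (D.τ n' - D.τ n₀)‖ := by ring_nf
        _ ≤ _ := norm_sub_le _ _
        _ ≤ T + T := add_le_add (hA n hn) (hA n' hn')
        _ = _ := by ring
    nlinarith
  have hE0 : 0 ≤ M * (H : ℝ) ^ 2 := by positivity
  have hηW : ∀ i, ‖η i / D.W‖ ≤ 1 := by
    intro i
    rw [norm_div, Complex.norm_real, Real.norm_of_nonneg (by positivity),
      div_le_one (by positivity)]
    exact hm i
  have hb : ∀ n ∈ A, Real.pi / y * (‖D.τ (n - n₀)‖ * D.W / H) ≤ R := by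
    intro n hn
    have h1 := hA n hn
    rw [← map_sub] at h1
    have h2 : ‖D.τ (n - n₀)‖ * D.W / H ≤ D.W := by
      rw [div_le_iff₀ hHpos, mul_comm]
      gcongr
      linarith
    have h3 : R = Real.pi / y * D.W := by rw [hR]; ring
    rw [h3]
    gcongr
  have hlamnorm : ∀ n ∈ A, ‖((Real.pi / y : ℝ) : ℂ) * (D.τ (n - n₀) * D.W / H)‖ ≤ R := by
    intro n hn
    refine le_of_eq_of_le ?_ (hb n hn)
    rw [norm_mul, norm_div, norm_mul, Complex.norm_real, Complex.norm_real, Complex.norm_natCast,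
      Real.norm_of_nonneg (by positivity), Real.norm_of_nonneg (by positivity)]
  have step1 := sum_norm_sq_mul_exp_le s A (fun i n => D.ψ (D.τ (n - n₀) * (D.τ (m i) / H))) hE0
    hgrid (fun n => ((Real.pi / y : ℝ) : ℂ) * (D.τ (n - n₀) * D.W / H)) (fun i => η i / D.W) hR0
    hlamnorm (fun i _ => hηW i)
  have step2 := sum_norm_sq_mul_exp_le s A _ (by positivity) step1
    (fun n => -starRingEnd ℂ (((Real.pi / y : ℝ) : ℂ) * (D.τ (n - n₀) * D.W / H)))
    (fun i => starRingEnd ℂ (η i / D.W)) hR0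
    (fun n hn => by rw [norm_neg, RCLike.norm_conj]; exact hlamnorm n hn)
    (fun i _ => by rw [RCLike.norm_conj]; exact hηW i) a
  have hWC : (D.W : ℂ) ≠ 0 := by exact_mod_cast (by positivity : D.W ≠ 0)
  have hphase : ∀ i ∈ s, ‖∑ n ∈ A, a n * D.ψ (D.τ n * x i)‖ ^ 2 =
      ‖∑ n ∈ A, a n * (D.ψ (D.τ (n - n₀) * (D.τ (m i) / H)) *
        Complex.exp (((Real.pi / y : ℝ) : ℂ) * (D.τ (n - n₀) * D.W / H) * (η i / D.W)) *
        Complex.exp (-starRingEnd ℂ (((Real.pi / y : ℝ) : ℂ) * (D.τ (n - n₀) * D.W / H)) *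
          starRingEnd ℂ (η i / D.W)))‖ ^ 2 := by
    intro i _
    have e : ∑ n ∈ A, a n * D.ψ (D.τ n * x i) = D.ψ (D.τ n₀ * x i) *
        ∑ n ∈ A, a n * D.ψ (D.τ (n - n₀) * (D.τ (m i) / H) + D.τ (n - n₀) * (η i / H)) := by
      rw [Finset.mul_sum]
      apply Finset.sum_congr rfl
      intro n _
      have : D.τ n * x i = D.τ n₀ * x i +
          (D.τ (n - n₀) * (D.τ (m i) / H) + D.τ (n - n₀) * (η i / H)) := by
        simp only [hη, map_sub]
        field_simp
        ring
      rw [this, ψ_add]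
      ring
    rw [e, norm_mul, norm_ψ, one_mul]
    congr 2
    apply Finset.sum_congr rfl
    intro n _
    rw [ψ_add, mul_assoc (D.ψ _) (Complex.exp _), ← Complex.exp_add]
    congr 2
    have e2 : ((Real.pi / y : ℝ) : ℂ) * (D.τ (n - n₀) * D.W / H) * (η i / D.W) =
        ((Real.pi / y : ℝ) : ℂ) * (D.τ (n - n₀) * (η i / H)) := by
      field_simp
    rw [neg_mul, ← map_mul, e2, map_mul, Complex.conj_ofReal, ψ]
    congr 1
    have e3 := Complex.sub_conj (D.τ (n - n₀) * (η i / H))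
    have hyC : (y : ℂ) ≠ 0 := by exact_mod_cast hy0.ne'
    rw [← sub_eq_add_neg, ← mul_sub, e3, ← hy]
    push_cast
    field_simp
  rw [Finset.sum_congr rfl hphase]
  refine step2.trans ?_
  have hS : 0 ≤ ∑ n ∈ A, ‖a n‖ ^ 2 := Finset.sum_nonneg fun _ _ => sq_nonneg _
  have hHle : (H : ℝ) ≤ (4 + D.W) * (T + 1 / κ) := by
    have h1 : 0 < 1 / κ := by positivity
    have h2 : D.W / κ = D.W * (1 / κ) := by ring
    rw [h2] at hH2
    nlinarith
  calc _ = (H : ℝ) ^ 2 * (M * (Real.exp R ^ 2 * Real.exp R ^ 2) * ∑ n ∈ A, ‖a n‖ ^ 2) := by ring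
    _ ≤ ((4 + D.W) * (T + 1 / κ)) ^ 2 *
        (M * (Real.exp R ^ 2 * Real.exp R ^ 2) * ∑ n ∈ A, ‖a n‖ ^ 2) := by gcongr
    _ = _ := by ring

lemma exists_residues {p : O} (hp : Prime p) : ∃ S : Finset O, (∀ c ∈ S, ¬ p ∣ c) ∧
    (∀ c ∈ S, ∀ c' ∈ S, p ∣ c - c' → c = c') ∧ (S.card : ℝ) = ‖D.τ p‖ ^ 2 - 1 ∧
    ∀ n, ¬ p ∣ n → ∑ c ∈ S, D.ψ (D.τ c * (D.τ n / D.τ p)) = -1 := by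
  classical
  have := D.finite_quot hp.ne_zero
  let _ := Fintype.ofFinite (O ⧸ Ideal.span {p})
  obtain ⟨rep, hrep⟩ : ∃ f : (O ⧸ Ideal.span {p}) → O, f = Quotient.out := ⟨_, rfl⟩
  have hmk : ∀ x : O ⧸ Ideal.span {p}, Ideal.Quotient.mk (Ideal.span {p}) (rep x) = x :=
    fun x => by rw [hrep]; exact Quotient.out_eq x
  have hinj : Function.Injective rep := by rw [hrep]; exact Quotient.out_injective
  have hdvd : ∀ a b : O, p ∣ a - b ↔
      Ideal.Quotient.mk (Ideal.span {p}) a = Ideal.Quotient.mk (Ideal.span {p}) b := by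
    intro a b
    rw [Ideal.Quotient.eq, Ideal.mem_span_singleton]
  have hout0 : p ∣ rep (0 : O ⧸ Ideal.span {p}) := by
    have := hdvd (rep (0 : O ⧸ Ideal.span {p})) 0
    rw [sub_zero, map_zero, hmk] at this
    exact this.2 rfl
  refine ⟨(Finset.univ.erase (0 : O ⧸ Ideal.span {p})).image rep, ?_, ?_, ?_, ?_⟩
  · intro c hc hd
    obtain ⟨x, hx, rfl⟩ := Finset.mem_image.1 hc
    have h1 := hdvd (rep x) 0
    rw [sub_zero, map_zero, hmk] at h1
    exact (Finset.mem_erase.1 hx).1 (h1.1 hd)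
  · intro c hc c' hc' hd
    obtain ⟨x, hx, rfl⟩ := Finset.mem_image.1 hc
    obtain ⟨x', hx', rfl⟩ := Finset.mem_image.1 hc'
    have h1 := (hdvd _ _).1 hd
    rw [hmk, hmk] at h1
    rw [h1]
  · rw [Finset.card_image_of_injective _ hinj, Finset.card_erase_of_mem (Finset.mem_univ _),
      ← D.card_quot p hp.ne_zero, Nat.card_eq_fintype_card, Finset.card_univ, Nat.cast_sub]
    · simp
    · exact Fintype.card_pos
  · intro n hn
    rw [Finset.sum_image (fun _ _ _ _ h => hinj h)]
    have h1 : ∑ x, D.ψ (D.τ (rep x) * (D.τ n / D.τ p)) = 0 := by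
      rw [hrep]; exact D.sum_ψ_quot hp.ne_zero hn
    rw [← Finset.add_sum_erase _ _ (Finset.mem_univ (0 : O ⧸ Ideal.span {p}))] at h1
    have h2 : D.ψ (D.τ (rep (0 : O ⧸ Ideal.span {p})) * (D.τ n / D.τ p)) = 1 := by
      obtain ⟨d, hd⟩ := hout0
      rw [hd]
      have : D.τ (p * d) * (D.τ n / D.τ p) = D.τ (d * n) := by
        have := D.τ_ne_zero hp.ne_zero
        simp only [map_mul]
        field_simp
      rw [this, ψ_τ]
    rw [h2] at h1
    linear_combination h1

/-- The sieve sum over squarefree products of elements of `I` of norm at most `z`. -/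
noncomputable def G (I : Finset O) (z : ℝ) : ℝ :=
  ∑ J ∈ I.powerset with ∏ p ∈ J, ‖D.τ p‖ ^ 2 ≤ z, ∏ p ∈ J, 1 / (‖D.τ p‖ ^ 2 - 1)

lemma dvd_numerator_sub [DecidableEq O] (J : Finset O) (c : ∀ p ∈ J, O) {p : O} (hp : p ∈ J) :
    p ∣ ∑ x ∈ J.attach, c x.1 x.2 * ∏ l ∈ J.erase x.1, l - c p hp * ∏ l ∈ J.erase p, l := by
  rw [← Finset.add_sum_erase _ _ (Finset.mem_attach J ⟨p, hp⟩), add_sub_cancel_left]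
  apply Finset.dvd_sum
  intro x hx
  apply Dvd.dvd.mul_left
  apply Finset.dvd_prod_of_mem
  refine Finset.mem_erase.2 ⟨?_, hp⟩
  intro h
  exact (Finset.mem_erase.1 hx).1 (Subtype.ext h.symm)

lemma not_dvd_prod {J : Finset O} {p : O} (hp : Prime p)
    (h : ∀ l ∈ J, ¬ p ∣ l) : ¬ p ∣ ∏ l ∈ J, l := by
  intro hd
  obtain ⟨l, hl, hd⟩ := (hp.dvd_finsetProd_iff _).1 hd
  exact h l hl hd

lemma τ_numerator [DecidableEq O] (J : Finset O) (hJ : ∀ p ∈ J, Prime p) (c : ∀ p ∈ J, O) :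
    D.τ (∑ x ∈ J.attach, c x.1 x.2 * ∏ l ∈ J.erase x.1, l) =
      D.τ (∏ l ∈ J, l) * ∑ x ∈ J.attach, D.τ (c x.1 x.2) / D.τ x.1 := by
  rw [map_sum, Finset.mul_sum]
  apply Finset.sum_congr rfl
  intro x _
  rw [← Finset.mul_prod_erase J (fun l => l) x.2, map_mul, map_mul]
  have := D.τ_ne_zero (hJ x.1 x.2).ne_zero
  field_simp

lemma norm_τ_prod (J : Finset O) : ‖D.τ (∏ l ∈ J, l)‖ ^ 2 = ∏ l ∈ J, ‖D.τ l‖ ^ 2 := by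
  rw [map_prod, norm_prod, Finset.prod_pow]

/-- The arithmetic form of the large sieve. -/
theorem sieve_bound [IsDomain O] : ∃ C : ℝ, 0 < C ∧ ∀ z T : ℝ, 1 ≤ z → 1 ≤ T → ∀ I : Finset O,
    (∀ p ∈ I, Prime p) → (∀ p ∈ I, ∀ l ∈ I, p ∣ l → p = l) →
    ∀ (B : Finset O) (n₀ : O), (∀ n ∈ B, ‖D.τ n - D.τ n₀‖ ≤ T) →
    (∀ p ∈ I, ∃ m : O, ∀ n ∈ B, ¬ p ∣ n - m) →
    B.card * D.G I z ≤ C * (T + z) ^ 2 := by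
  classical
  obtain ⟨C, hC, hLS⟩ := D.large_sieve
  refine ⟨9 * C, by positivity, ?_⟩
  intro z T hz hT I hI hI2 B n₀ hB hm
  choose! S hS1 hS2 hS3 hS4 using fun (p : O) (hp : p ∈ I) => D.exists_residues (hI p hp)
  choose! m hm using hm
  let x : (Σ J : Finset O, ∀ p ∈ J, O) → ℂ := fun i =>
    ∑ l ∈ i.1.attach, D.τ (i.2 l.1 l.2) / D.τ l.1
  set P := I.powerset.filter (fun J => ∏ p ∈ J, ‖D.τ p‖ ^ 2 ≤ z) with hP
  have hPI : ∀ J ∈ P, J ⊆ I ∧ ∏ p ∈ J, ‖D.τ p‖ ^ 2 ≤ z := by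
    intro J hJ
    simpa [hP] using hJ
  set s : Finset (Σ J : Finset O, ∀ p ∈ J, O) := P.sigma (fun J => J.pi S) with hs
  have hspace : ∀ α : ℂ, ∀ s' ⊆ s, (∀ i ∈ s', ∃ o : O, ‖x i - α - D.τ o‖ ≤ 1 / (3 * z)) →
      (s'.card : ℝ) ≤ 1 := by
    intro α s' hs' hα
    have : s'.card ≤ 1 := by
      rw [Finset.card_le_one]
      rintro ⟨J, c⟩ hi ⟨J', c'⟩ hi'
      obtain ⟨o, ho⟩ := hα _ hi
      obtain ⟨o', ho'⟩ := hα _ hi'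
      have h1 := Finset.mem_sigma.1 (hs' hi)
      have h1' := Finset.mem_sigma.1 (hs' hi')
      simp only at h1 h1'
      obtain ⟨hJ, hc⟩ := h1
      obtain ⟨hJ', hc'⟩ := h1'
      obtain ⟨hJI, hJz⟩ := hPI J hJ
      obtain ⟨hJI', hJz'⟩ := hPI J' hJ'
      rw [Finset.mem_pi] at hc hc'
      set X := ∑ x ∈ J.attach, c x.1 x.2 * ∏ l ∈ J.erase x.1, l with hX
      set X' := ∑ x ∈ J'.attach, c' x.1 x.2 * ∏ l ∈ J'.erase x.1, l with hX'
      have hXx := D.τ_numerator J (fun p hp => hI p (hJI hp)) c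
      have hXx' := D.τ_numerator J' (fun p hp => hI p (hJI' hp)) c'
      rw [← hX] at hXx
      rw [← hX'] at hXx'
      have hq := D.norm_τ_prod J
      have hq' := D.norm_τ_prod J'
      set q := ∏ l ∈ J, l with hqd
      set q' := ∏ l ∈ J', l with hqd'
      have hqn : q ≠ 0 := Finset.prod_ne_zero_iff.2 fun p hp => (hI p (hJI hp)).ne_zero
      have hkey : X * q' - X' * q - (o - o') * (q * q') = 0 := by
        by_contra hne
        have h2 := D.one_le_norm_τ hne
        have h3 : D.τ (X * q' - X' * q - (o - o') * (q * q')) =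
            D.τ q * D.τ q' * ((x ⟨J, c⟩ - α - D.τ o) - (x ⟨J', c'⟩ - α - D.τ o')) := by
          simp only [map_sub, map_mul, hXx, hXx', x]
          ring
        rw [h3, norm_mul, norm_mul] at h2
        have h4 : ‖(x ⟨J, c⟩ - α - D.τ o) - (x ⟨J', c'⟩ - α - D.τ o')‖ ≤ 2 / (3 * z) := by
          refine (norm_sub_le _ _).trans ((add_le_add ho ho').trans (le_of_eq ?_))
          ring
        have h5 : ‖D.τ q‖ * ‖D.τ q'‖ ≤ z := by
          rw [← hq] at hJz
          rw [← hq'] at hJz'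
          nlinarith [sq_nonneg (‖D.τ q‖ - ‖D.τ q'‖)]
        have h6 : ‖D.τ q‖ * ‖D.τ q'‖ * ‖(x ⟨J, c⟩ - α - D.τ o) - (x ⟨J', c'⟩ - α - D.τ o')‖ ≤
            z * (2 / (3 * z)) := by gcongr
        have h7 : z * (2 / (3 * z)) = 2 / 3 := by field_simp
        linarith
      have hnd : ∀ (J : Finset O) (hJI : J ⊆ I) (p : O) (hp : p ∈ J),
          ¬ p ∣ ∏ l ∈ J.erase p, l := by
        intro J hJI p hp
        apply not_dvd_prod (hI p (hJI hp))
        intro l hl hd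
        exact (Finset.mem_erase.1 hl).1
          (hI2 p (hJI hp) l (hJI (Finset.mem_of_mem_erase hl)) hd).symm
      have hsub : ∀ (J J' : Finset O) (hJI : J ⊆ I) (hJI' : J' ⊆ I) (c : ∀ p ∈ J, O)
          (hc : ∀ p (hp : p ∈ J), c p hp ∈ S p) (X' o : O),
          (∑ x ∈ J.attach, c x.1 x.2 * ∏ l ∈ J.erase x.1, l) * (∏ l ∈ J', l) =
            X' * (∏ l ∈ J, l) + o * ((∏ l ∈ J, l) * (∏ l ∈ J', l)) → J ⊆ J' := by
        intro J J' hJI hJI' c hc X' o h p hp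
        by_contra hpJ'
        have hpp := hI p (hJI hp)
        have hpq : p ∣ ∏ l ∈ J, l := Finset.dvd_prod_of_mem _ hp
        have h2 : p ∣ (∑ x ∈ J.attach, c x.1 x.2 * ∏ l ∈ J.erase x.1, l) * (∏ l ∈ J', l) := by
          rw [h]
          exact dvd_add (hpq.mul_left _) ((hpq.mul_right _).mul_left _)
        rcases hpp.dvd_or_dvd h2 with h3 | h3
        · have h4 := (dvd_sub_right h3).1 (dvd_numerator_sub J c hp)
          rcases hpp.dvd_or_dvd h4 with h5 | h5
          · exact hS1 p (hJI hp) _ (hc p hp) h5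
          · exact hnd J hJI p hp h5
        · refine not_dvd_prod hpp ?_ h3
          intro l hl hd
          rw [hI2 p (hJI hp) l (hJI' hl) hd] at hpJ'
          exact hpJ' hl
      have hJJ : J = J' := by
        apply Finset.Subset.antisymm
        · exact hsub J J' hJI hJI' c hc X' (o - o') (by linear_combination hkey)
        · exact hsub J' J hJI' hJI c' hc' X (o' - o) (by linear_combination -hkey)
      subst hJJ
      have hkey2 : X - X' = (o - o') * q := by
        apply mul_right_cancel₀ hqn
        linear_combination hkey
      congr 1
      funext p hp
      apply hS2 p (hJI hp) _ (hc p hp) _ (hc' p hp)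
      have h2 := dvd_sub (dvd_numerator_sub J c hp) (dvd_numerator_sub J c' hp)
      rw [← hX, ← hX'] at h2
      have hpq : p ∣ q := Finset.dvd_prod_of_mem _ hp
      have h3 : p ∣ (c p hp - c' p hp) * ∏ l ∈ J.erase p, l := by
        have e : (c p hp - c' p hp) * ∏ l ∈ J.erase p, l = (o - o') * q -
          (X - c p hp * ∏ l ∈ J.erase p, l - (X' - c' p hp * ∏ l ∈ J.erase p, l)) := by
          rw [← hkey2]; ring
        rw [e]
        exact dvd_sub (hpq.mul_left _) h2
      rcases (hI p (hJI hp)).dvd_or_dvd h3 with h4 | h4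
      · exact h4
      · exact absurd h4 (hnd J hJI p hp)
    exact_mod_cast this
  have hls := hLS T (1 / (3 * z)) 1 hT (by positivity) zero_le_one _ s x hspace B n₀ hB (fun _ => 1)
  simp only [one_mul, norm_one, one_pow, Finset.sum_const, nsmul_eq_mul, mul_one, one_div_one_div]
    at hls
  have hlow : (B.card : ℝ) ^ 2 * D.G I z ≤ ∑ i ∈ s, ‖∑ n ∈ B, D.ψ (D.τ n * x i)‖ ^ 2 := by
    rw [hs, Finset.sum_sigma, G, Finset.mul_sum]
    apply Finset.sum_le_sum
    intro J hJ
    obtain ⟨hJI, hJz⟩ := hPI J hJ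
    have h1 : ∀ n ∈ B, ∑ c ∈ J.pi S, ∏ l ∈ J.attach,
        D.ψ (D.τ (c l.1 l.2) * (D.τ (n - m l.1) / D.τ l.1)) = ∏ l ∈ J, (-1) := by
      intro n hn
      rw [← Finset.prod_sum J S (fun l b => D.ψ (D.τ b * (D.τ (n - m l) / D.τ l)))]
      apply Finset.prod_congr rfl
      intro l hl
      exact hS4 l (hJI hl) _ (hm l (hJI hl) n hn)
    have h2 : (B.card : ℝ) ≤ ∑ c ∈ J.pi S, ‖∑ n ∈ B, D.ψ (D.τ n * x ⟨J, c⟩)‖ := by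
      calc (B.card : ℝ) = ‖∑ n ∈ B, ∑ c ∈ J.pi S, ∏ l ∈ J.attach,
            D.ψ (D.τ (c l.1 l.2) * (D.τ (n - m l.1) / D.τ l.1))‖ := by
            rw [Finset.sum_congr rfl h1]
            simp
        _ = ‖∑ c ∈ J.pi S, (∏ l ∈ J.attach, D.ψ (-(D.τ (c l.1 l.2) * (D.τ (m l.1) / D.τ l.1)))) *
              ∑ n ∈ B, D.ψ (D.τ n * x ⟨J, c⟩)‖ := by
            rw [Finset.sum_comm]
            congr 1
            apply Finset.sum_congr rfl
            intro c _
            rw [Finset.mul_sum]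
            apply Finset.sum_congr rfl
            intro n _
            simp only [x]
            rw [Finset.mul_sum, ψ_sum, ← Finset.prod_mul_distrib]
            apply Finset.prod_congr rfl
            intro l _
            rw [← ψ_add]
            congr 1
            rw [map_sub]
            ring
        _ ≤ _ := by
            refine (norm_sum_le _ _).trans (Finset.sum_le_sum fun c _ => ?_)
            rw [norm_mul, norm_prod, Finset.prod_congr rfl fun l _ => D.norm_ψ _]
            simp
    have h3 : ((J.pi S).card : ℝ) = ∏ l ∈ J, (‖D.τ l‖ ^ 2 - 1) := by
      rw [Finset.card_pi]
      push_cast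
      exact Finset.prod_congr rfl fun l hl => hS3 l (hJI hl)
    have h4 := sq_sum_le_card_mul_sum_sq (s := J.pi S)
      (f := fun c => ‖∑ n ∈ B, D.ψ (D.τ n * x ⟨J, c⟩)‖)
    have h5 : (B.card : ℝ) ^ 2 ≤ (∏ l ∈ J, (‖D.τ l‖ ^ 2 - 1)) *
        ∑ c ∈ J.pi S, ‖∑ n ∈ B, D.ψ (D.τ n * x ⟨J, c⟩)‖ ^ 2 := by
      rw [← h3]
      refine le_trans ?_ h4
      gcongr
    have h6 : 0 < ∏ l ∈ J, (‖D.τ l‖ ^ 2 - 1) := by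
      apply Finset.prod_pos
      intro l hl
      have := D.two_le_of_prime (hI l (hJI hl))
      linarith
    rw [Finset.prod_div_distrib, Finset.prod_const_one, mul_one_div, div_le_iff₀ h6, mul_comm]
    exact h5
  have h3z : (T + 3 * z) ^ 2 ≤ 9 * (T + z) ^ 2 := by nlinarith
  have hfin : (B.card : ℝ) * (B.card * D.G I z) ≤ B.card * (9 * C * (T + z) ^ 2) := by
    calc (B.card : ℝ) * (B.card * D.G I z) = (B.card : ℝ) ^ 2 * D.G I z := by ring
      _ ≤ C * (T + 3 * z) ^ 2 * B.card := hlow.trans hls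
      _ ≤ C * (9 * (T + z) ^ 2) * B.card := by gcongr
      _ = _ := by ring
  rcases Nat.eq_zero_or_pos B.card with h0 | h0
  · rw [h0]; simp; positivity
  · exact le_of_mul_le_mul_left hfin (by exact_mod_cast h0)

/-- The nonzero elements of norm at most `x`. -/
noncomputable def ball (x : ℝ) : Finset O :=
  ((D.finite_norm_le (√x)).subset
    (t := {m : O | m ≠ 0 ∧ ‖D.τ m‖ ^ 2 ≤ x}) (fun _ hm => Real.le_sqrt_of_sq_le hm.2)).toFinset

lemma mem_ball {x : ℝ} {m : O} : m ∈ D.ball x ↔ m ≠ 0 ∧ ‖D.τ m‖ ^ 2 ≤ x := by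
  simp [ball]

lemma norm_sq_pos {m : O} (hm : m ≠ 0) : 0 < ‖D.τ m‖ ^ 2 := pow_pos (D.norm_τ_pos hm) 2

lemma one_le_norm_sq {m : O} (hm : m ≠ 0) : 1 ≤ ‖D.τ m‖ ^ 2 :=
  one_le_pow₀ (D.one_le_norm_τ hm)

lemma norm_sq_mul (a b : O) : ‖D.τ (a * b)‖ ^ 2 = ‖D.τ a‖ ^ 2 * ‖D.τ b‖ ^ 2 := by
  rw [map_mul, norm_mul, mul_pow]

lemma norm_sq_le_of_dvd {a b : O} (h : a ∣ b) (hb : b ≠ 0) : ‖D.τ a‖ ^ 2 ≤ ‖D.τ b‖ ^ 2 := by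
  obtain ⟨c, rfl⟩ := h
  rw [norm_sq_mul]
  have hc : c ≠ 0 := by rintro rfl; simp at hb
  have := D.one_le_norm_sq hc
  nlinarith [sq_nonneg ‖D.τ a‖]

lemma norm_sq_eq_of_associated {a b : O} (h : Associated a b) : ‖D.τ a‖ ^ 2 = ‖D.τ b‖ ^ 2 := by
  by_cases hb : b = 0
  · rw [hb, associated_zero_iff_eq_zero] at h
    rw [hb, h]
  · have ha : a ≠ 0 := fun h0 => hb ((associated_zero_iff_eq_zero b).1 (h0 ▸ h.symm))
    exact le_antisymm (D.norm_sq_le_of_dvd h.dvd hb) (D.norm_sq_le_of_dvd h.symm.dvd ha)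

lemma ball_mono {x y : ℝ} (h : x ≤ y) : D.ball x ⊆ D.ball y := by
  intro m hm
  rw [mem_ball] at hm ⊢
  exact ⟨hm.1, hm.2.trans h⟩

open Classical in
lemma sum_ball_dvd [IsDomain O] {p : O} (hp : p ≠ 0) (x : ℝ) (pr : O → Prop) (f : O → ℝ) :
    ∑ m ∈ D.ball x with pr m ∧ p ∣ m, f m =
      ∑ m ∈ D.ball (x / ‖D.τ p‖ ^ 2) with pr (p * m), f (p * m) := by
  symm
  apply Finset.sum_nbij (fun m => p * m)
  · intro m hm
    rw [Finset.mem_filter, mem_ball] at hm ⊢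
    refine ⟨⟨mul_ne_zero hp hm.1.1, ?_⟩, hm.2, dvd_mul_right _ _⟩
    rw [norm_sq_mul, mul_comm]
    exact (le_div_iff₀ (D.norm_sq_pos hp)).1 hm.1.2
  · intro a _ b _ h
    exact mul_left_cancel₀ hp h
  · intro m hm
    simp only [Finset.coe_filter, Set.mem_ofPred_eq, mem_ball] at hm
    obtain ⟨⟨h0, hx⟩, hpr, d, rfl⟩ := hm
    refine ⟨d, ?_, rfl⟩
    simp only [Finset.coe_filter, Set.mem_ofPred_eq, mem_ball]
    refine ⟨⟨fun h => h0 (by rw [h, mul_zero]), ?_⟩, hpr⟩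
    rw [le_div_iff₀ (D.norm_sq_pos hp), mul_comm, ← norm_sq_mul]
    exact hx
  · intro _ _; rfl

/-- All prime factors of `m` are associated to elements of `P`. -/
def Smooth (P : Finset O) (m : O) : Prop := ∀ l, Prime l → l ∣ m → ∃ p ∈ P, Associated l p

lemma Smooth.of_mul {P : Finset O} {a m : O} (h : Smooth P (a * m)) : Smooth P m :=
  fun l hl hd => h l hl (hd.mul_left a)

/-- The sum of the inverse norms of smooth elements. -/
noncomputable def Z (P : Finset O) (x : ℝ) : ℝ :=
  open Classical in ∑ m ∈ D.ball x with Smooth P m, 1 / ‖D.τ m‖ ^ 2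

/-- The sum of the inverse norms. -/
noncomputable def L (x : ℝ) : ℝ := ∑ m ∈ D.ball x, 1 / ‖D.τ m‖ ^ 2

lemma Z_nonneg (P : Finset O) (x : ℝ) : 0 ≤ D.Z P x :=
  Finset.sum_nonneg fun _ _ => by positivity

lemma Z_mono (P : Finset O) {x y : ℝ} (h : x ≤ y) : D.Z P x ≤ D.Z P y := by
  classical
  apply Finset.sum_le_sum_of_subset_of_nonneg
  · exact Finset.filter_subset_filter _ (D.ball_mono h)
  · intros; positivity

lemma Z_eq_zero (P : Finset O) {x : ℝ} (h : x < 1) : D.Z P x = 0 := by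
  classical
  apply Finset.sum_eq_zero
  intro m hm
  rw [Finset.mem_filter, mem_ball] at hm
  have := D.one_le_norm_sq hm.1.1
  linarith [hm.1.2]

lemma Z_le_L (P : Finset O) (x : ℝ) : D.Z P x ≤ D.L x := by
  classical
  apply Finset.sum_le_sum_of_subset_of_nonneg (Finset.filter_subset _ _)
  intros; positivity

lemma div_le_self_of_prime {p : O} (hp : Prime p) {x : ℝ} (hx : 0 ≤ x) : x / ‖D.τ p‖ ^ 2 ≤ x :=
  div_le_self hx (D.one_le_norm_sq hp.ne_zero)

lemma Z_insert [IsDomain O] [DecidableEq O] (P : Finset O) {p : O} (hp : Prime p) (x : ℝ) :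
    D.Z (insert p P) x ≤ D.Z P x + 1 / ‖D.τ p‖ ^ 2 * D.Z (insert p P) (x / ‖D.τ p‖ ^ 2) := by
  classical
  conv_lhs => rw [Z]
  rw [← Finset.sum_filter_not_add_sum_filter _ (fun m => p ∣ m), Finset.filter_filter,
    Finset.filter_filter]
  have h1 := D.sum_ball_dvd hp.ne_zero x (Smooth (insert p P)) (fun m => 1 / ‖D.τ m‖ ^ 2)
  apply add_le_add
  · apply Finset.sum_le_sum_of_subset_of_nonneg
    · intro m hm
      rw [Finset.mem_filter] at hm ⊢
      refine ⟨hm.1, ?_⟩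
      intro l hl hd
      obtain ⟨q, hq, hlq⟩ := hm.2.1 l hl hd
      rcases Finset.mem_insert.1 hq with rfl | hq
      · exact absurd (hlq.symm.dvd.trans hd) hm.2.2
      · exact ⟨q, hq, hlq⟩
    · intros; positivity
  · rw [h1, Z, Finset.mul_sum]
    simp only [norm_sq_mul, one_div_mul_one_div]
    apply Finset.sum_le_sum_of_subset_of_nonneg
    · intro m hm
      rw [Finset.mem_filter] at hm ⊢
      exact ⟨hm.1, hm.2.of_mul⟩
    · intros; positivity

lemma Z_insert_le_mul [IsDomain O] [DecidableEq O] (P : Finset O) {p : O} (hp : Prime p) (x : ℝ) :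
    D.Z (insert p P) x ≤ D.Z P x * (‖D.τ p‖ ^ 2 / (‖D.τ p‖ ^ 2 - 1)) := by
  have h2 := D.two_le_of_prime hp
  rcases lt_or_ge x 1 with hx | hx
  · rw [Z_eq_zero _ _ hx, Z_eq_zero _ _ hx]; simp
  have h1 := D.Z_insert P hp x
  have h3 := D.Z_mono (insert p P) (D.div_le_self_of_prime hp (by linarith : 0 ≤ x))
  set N := ‖D.τ p‖ ^ 2
  rw [mul_div_assoc', le_div_iff₀ (by linarith)]
  have h4 : N * D.Z (insert p P) x ≤ N * D.Z P x + D.Z (insert p P) (x / N) := by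
    calc _ ≤ N * (D.Z P x + 1 / N * D.Z (insert p P) (x / N)) := by gcongr
      _ = _ := by field_simp
  linarith

lemma Z_insert_le_add [IsDomain O] [DecidableEq O] (P : Finset O) {p : O} (hp : Prime p) (x : ℝ) :
    D.Z (insert p P) x ≤
      D.Z P x + 1 / (‖D.τ p‖ ^ 2 - 1) * D.Z P (x / ‖D.τ p‖ ^ 2) := by
  have h2 := D.two_le_of_prime hp
  have h1 := D.Z_insert P hp x
  have h3 := D.Z_insert_le_mul P hp (x / ‖D.τ p‖ ^ 2)
  refine h1.trans ?_
  refine add_le_add le_rfl ?_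
  calc _ ≤ 1 / ‖D.τ p‖ ^ 2 * (D.Z P (x / ‖D.τ p‖ ^ 2) * (‖D.τ p‖ ^ 2 / (‖D.τ p‖ ^ 2 - 1))) := by
        gcongr
    _ = _ := by
      have h4 : ‖D.τ p‖ ^ 2 - 1 ≠ 0 := by linarith
      have h5 : ‖D.τ p‖ ^ 2 ≠ 0 := by linarith
      generalize ‖D.τ p‖ ^ 2 = N at *
      field_simp

lemma G_insert [DecidableEq O] (I : Finset O) {p : O} (hp : Prime p) (hpI : p ∉ I) (x : ℝ) :
    D.G (insert p I) x =
      D.G I x + 1 / (‖D.τ p‖ ^ 2 - 1) * D.G I (x / ‖D.τ p‖ ^ 2) := by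
  have h2 := D.two_le_of_prime hp
  simp only [G, Finset.sum_filter]
  rw [Finset.sum_powerset_insert hpI, Finset.mul_sum]
  congr 1
  apply Finset.sum_congr rfl
  intro J hJ
  have hpJ : p ∉ J := fun h => hpI (Finset.mem_powerset.1 hJ h)
  have h3 : ‖D.τ p‖ ^ 2 * ∏ q ∈ J, ‖D.τ q‖ ^ 2 ≤ x ↔
      ∏ q ∈ J, ‖D.τ q‖ ^ 2 ≤ x / ‖D.τ p‖ ^ 2 := by
    rw [mul_comm, le_div_iff₀ (by linarith)]
  simp only [Finset.prod_insert hpJ, h3]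
  split_ifs <;> simp

lemma Z_union_le_G [IsDomain O] [DecidableEq O] (P : Finset O) {B : ℝ}
    (hP : ∀ y, D.Z P y ≤ B) (I : Finset O) (hI : ∀ p ∈ I, Prime p) (y : ℝ) :
    D.Z (I ∪ P) y ≤ B * D.G I y := by
  induction I using Finset.induction_on generalizing y with
  | empty =>
    rw [Finset.empty_union]
    rcases lt_or_ge y 1 with hy | hy
    · rw [Z_eq_zero _ _ hy, G, Finset.sum_filter]
      simp [hy.not_ge]
    · rw [G, Finset.sum_filter]
      simpa [hy] using hP y
  | insert p I hpI ih =>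
    have hp := hI p (Finset.mem_insert_self _ _)
    have hI' : ∀ q ∈ I, Prime q := fun q hq => hI q (Finset.mem_insert_of_mem hq)
    have h2 := D.two_le_of_prime hp
    have h3 : 0 ≤ 1 / (‖D.τ p‖ ^ 2 - 1) := one_div_nonneg.2 (by linarith)
    rw [Finset.insert_union, D.G_insert I hp hpI]
    refine (D.Z_insert_le_add _ hp y).trans ?_
    have h4 := ih hI' y
    have h5 := mul_le_mul_of_nonneg_left (ih hI' (y / ‖D.τ p‖ ^ 2)) h3
    linarith

lemma Z_union_le_prod [IsDomain O] [DecidableEq O] (P : Finset O) {B : ℝ}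
    (hP : ∀ y, D.Z P y ≤ B) (I : Finset O) (hI : ∀ p ∈ I, Prime p) (y : ℝ) :
    D.Z (I ∪ P) y ≤ B * ∏ p ∈ I, (‖D.τ p‖ ^ 2 / (‖D.τ p‖ ^ 2 - 1)) := by
  induction I using Finset.induction_on with
  | empty => simpa using hP y
  | insert p I hpI ih =>
    have hp := hI p (Finset.mem_insert_self _ _)
    have hI' : ∀ q ∈ I, Prime q := fun q hq => hI q (Finset.mem_insert_of_mem hq)
    have h2 := D.two_le_of_prime hp
    have h3 : 0 ≤ ‖D.τ p‖ ^ 2 / (‖D.τ p‖ ^ 2 - 1) := div_nonneg (by linarith) (by linarith)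
    rw [Finset.insert_union, Finset.prod_insert hpI]
    refine (D.Z_insert_le_mul _ hp y).trans ?_
    have h4 := mul_le_mul_of_nonneg_right (ih hI') h3
    linarith

lemma exists_L_lower : ∃ c : ℝ, 0 < c ∧ ∀ x : ℝ, 1 ≤ x → c * Real.log x ≤ D.L x := by
  classical
  have hW := D.one_le_W
  refine ⟨1 / (4 * D.W ^ 2), by positivity, ?_⟩
  intro x hx
  have hlogW : Real.log D.W ≤ D.W :=
    (Real.log_le_sub_one_of_pos (by positivity)).trans (by linarith)
  rcases lt_or_ge x (D.W ^ 4) with h | h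
  · have h1 : Real.log x ≤ 4 * Real.log D.W := by
      rw [← Nat.cast_ofNat, ← Real.log_pow]
      exact Real.log_le_log (by linarith) h.le
    have h2 : (1 : ℝ) ≤ D.L x := by
      have hone : (1 : O) ∈ D.ball x := by
        rw [mem_ball]
        refine ⟨?_, by simpa using hx⟩
        intro h0
        have := D.τ.map_one
        rw [h0, map_zero] at this
        exact zero_ne_one this
      have := Finset.single_le_sum (f := fun m => 1 / ‖D.τ m‖ ^ 2) (fun _ _ => by positivity) hone
      simpa [L] using this
    refine le_trans ?_ h2
    rw [one_div_mul_eq_div, div_le_one (by positivity)]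
    nlinarith
  · set K := ⌊√x / D.W⌋₊ with hK
    have hxK : √x / D.W ≤ K + 1 := (Nat.lt_floor_add_one _).le
    have hKx : (K : ℝ) * D.W ≤ √x := by
      rw [← le_div_iff₀ (by positivity)]
      exact Nat.floor_le (by positivity)
    have hsum : ∑ k ∈ Finset.range K, (1 / D.W ^ 2) * ((k : ℝ) + 1)⁻¹ ≤ D.L x := by
      calc ∑ k ∈ Finset.range K, (1 / D.W ^ 2) * ((k : ℝ) + 1)⁻¹
          = ∑ k ∈ Finset.range K, ∑ v ∈ Finset.range (k + 1), 1 / (((k : ℝ) + 1) * D.W) ^ 2 := by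
            apply Finset.sum_congr rfl
            intro k _
            rw [Finset.sum_const, Finset.card_range, nsmul_eq_mul]
            push_cast
            field_simp
        _ = ∑ i ∈ (Finset.range K).sigma (fun k => Finset.range (k + 1)),
              1 / (((i.1 : ℝ) + 1) * D.W) ^ 2 := by rw [Finset.sum_sigma]
        _ ≤ ∑ i ∈ (Finset.range K).sigma (fun k => Finset.range (k + 1)),
              1 / ‖D.τ (((i.1 + 1 : ℕ) : ℤ) + ((i.2 : ℕ) : ℤ) * D.ω)‖ ^ 2 := by
            apply Finset.sum_le_sum
            rintro ⟨k, v⟩ hi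
            rw [Finset.mem_sigma, Finset.mem_range, Finset.mem_range] at hi
            have h1 := D.norm_coord_le ((k + 1 : ℕ) : ℝ) (v : ℝ) (B := (k : ℝ) + 1)
              (by rw [Nat.abs_cast]; push_cast; exact le_rfl)
              (by rw [Nat.abs_cast]; exact_mod_cast hi.2.le)
            have h2 : D.τ (((k + 1 : ℕ) : ℤ) + ((v : ℕ) : ℤ) * D.ω) =
              (((k + 1 : ℕ) : ℝ) : ℂ) + ((v : ℝ) : ℂ) * D.τ D.ω := by
              rw [τ_coord]; push_cast; rfl
            simp only
            rw [h2]
            apply one_div_le_one_div_of_le _ (by gcongr)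
            apply pow_pos
            rw [← h2]
            apply norm_pos_iff.2
            intro h0
            have h3 := (D.abs_coord_le ((k + 1 : ℕ) : ℤ) (v : ℤ)).1
            rw [h0, norm_zero, mul_zero] at h3
            have h4 := abs_nonpos_iff.1 h3
            norm_cast at h4
        _ = ∑ m ∈ ((Finset.range K).sigma (fun k => Finset.range (k + 1))).image
              (fun i : (_ : ℕ) × ℕ => (((i.1 + 1 : ℕ) : ℤ) + ((i.2 : ℕ) : ℤ) * D.ω : O)),
              1 / ‖D.τ m‖ ^ 2 := by
            rw [Finset.sum_image]
            rintro ⟨k, v⟩ _ ⟨k', v'⟩ _ h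
            simp only at h
            have h1 := D.abs_coord_le (((k + 1 : ℕ) : ℤ) - ((k' + 1 : ℕ) : ℤ)) ((v : ℤ) - (v' : ℤ))
            have h2 : ((((k + 1 : ℕ) : ℤ) - ((k' + 1 : ℕ) : ℤ) : ℤ) : O) +
                (((v : ℤ) - (v' : ℤ) : ℤ) : O) * D.ω = 0 := by
              push_cast at h ⊢
              linear_combination h
            rw [h2, map_zero, norm_zero, mul_zero] at h1
            have h3 := abs_nonpos_iff.1 h1.1
            have h4 := abs_nonpos_iff.1 h1.2
            rw [Int.cast_eq_zero] at h3 h4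
            have h5 : k = k' := by push_cast at h3; omega
            have h6 : v = v' := by omega
            rw [h5, h6]
        _ ≤ D.L x := by
            apply Finset.sum_le_sum_of_subset_of_nonneg
            · intro m hm
              obtain ⟨⟨k, v⟩, hi, rfl⟩ := Finset.mem_image.1 hm
              rw [Finset.mem_sigma, Finset.mem_range, Finset.mem_range] at hi
              rw [mem_ball]
              constructor
              · intro h0
                have h3 := (D.abs_coord_le ((k + 1 : ℕ) : ℤ) (v : ℤ)).1
                rw [h0, map_zero, norm_zero, mul_zero] at h3
                have h4 := abs_nonpos_iff.1 h3
                norm_cast at h4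
              · have hkK : (k : ℝ) + 1 ≤ K := by exact_mod_cast hi.1
                have h1 := D.norm_coord_le ((k + 1 : ℕ) : ℝ) (v : ℝ) (B := (K : ℝ))
                  (by rw [Nat.abs_cast]; push_cast; exact hkK)
                  (by rw [Nat.abs_cast]; exact_mod_cast (hi.2.le.trans hi.1))
                have h2 : D.τ (((k + 1 : ℕ) : ℤ) + ((v : ℕ) : ℤ) * D.ω) =
                    (((k + 1 : ℕ) : ℝ) : ℂ) + ((v : ℝ) : ℂ) * D.τ D.ω := by
                  rw [τ_coord]; push_cast; rfl
                rw [← h2] at h1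
                calc _ ≤ (√x) ^ 2 := by gcongr; exact h1.trans hKx
                  _ = x := Real.sq_sqrt (by linarith)
            · intros; positivity
    rw [← Finset.mul_sum] at hsum
    have hharm := log_add_one_le_harmonic K
    rw [harmonic] at hharm
    push_cast at hharm
    refine le_trans ?_ ((mul_le_mul_of_nonneg_left hharm (by positivity)).trans hsum)
    have h1 : Real.log (√x / D.W) ≤ Real.log (K + 1) :=
      Real.log_le_log (by positivity) hxK
    rw [Real.log_div (by positivity) (by positivity), Real.log_sqrt (by linarith)] at h1
    have h2 : 4 * Real.log D.W ≤ Real.log x := by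
      rw [← Nat.cast_ofNat, ← Real.log_pow]
      exact Real.log_le_log (by positivity) h
    calc 1 / (4 * D.W ^ 2) * Real.log x = 1 / D.W ^ 2 * (Real.log x / 4) := by field_simp
      _ ≤ _ := by gcongr; linarith

lemma exists_L_upper : ∃ C : ℝ, 0 < C ∧ ∀ x : ℝ, 1 ≤ x → D.L x ≤ C * (1 + Real.log x) := by
  have hA := D.one_le_A
  refine ⟨25 * D.A ^ 2, by positivity, ?_⟩
  intro x hx
  have hsx : 1 ≤ √x := Real.one_le_sqrt.2 hx
  set K := Nat.log 2 ⌊√x⌋₊ with hK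
  have hmaps : ∀ m ∈ D.ball x, Nat.log 2 ⌊‖D.τ m‖⌋₊ ∈ Finset.range (K + 1) := by
    intro m hm
    rw [mem_ball] at hm
    rw [Finset.mem_range, Nat.lt_succ_iff]
    apply Nat.log_mono_right
    apply Nat.floor_le_floor
    exact Real.le_sqrt_of_sq_le hm.2
  rw [L, ← Finset.sum_fiberwise_of_maps_to hmaps]
  have hfib : ∀ k ∈ Finset.range (K + 1),
      ∑ m ∈ D.ball x with Nat.log 2 ⌊‖D.τ m‖⌋₊ = k, 1 / ‖D.τ m‖ ^ 2 ≤ 25 * D.A ^ 2 := by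
    intro k _
    have hk : ∀ m ∈ (D.ball x).filter (fun m => Nat.log 2 ⌊‖D.τ m‖⌋₊ = k),
        (2 : ℝ) ^ k ≤ ‖D.τ m‖ ∧ ‖D.τ m‖ ≤ 2 * 2 ^ k := by
      intro m hm
      rw [Finset.mem_filter, mem_ball] at hm
      have h1 := D.one_le_norm_τ hm.1.1
      have h0 : ⌊‖D.τ m‖⌋₊ ≠ 0 := by
        have := (Nat.one_le_floor_iff _).2 h1
        omega
      constructor
      · have h2 := Nat.pow_log_le_self 2 h0
        rw [hm.2] at h2
        have h3 := Nat.floor_le (norm_nonneg (D.τ m))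
        have h4 : ((2 ^ k : ℕ) : ℝ) ≤ (⌊‖D.τ m‖⌋₊ : ℝ) := by exact_mod_cast h2
        push_cast at h4
        linarith
      · have h2 := Nat.lt_pow_succ_log_self (b := 2) (by norm_num) ⌊‖D.τ m‖⌋₊
        rw [hm.2] at h2
        have h3 := (Nat.lt_floor_add_one (‖D.τ m‖)).le
        have h4 : ((⌊‖D.τ m‖⌋₊ + 1 : ℕ) : ℝ) ≤ ((2 ^ (k + 1) : ℕ) : ℝ) := by exact_mod_cast h2
        push_cast at h4
        rw [pow_succ] at h4
        linarith
    have hcard := D.card_le_of_norm_sub_le _ (2 * 2 ^ k) 0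
      (fun m hm => by simpa using (hk m hm).2)
    have hpk : (1 : ℝ) ≤ 2 ^ k := one_le_pow₀ (by norm_num)
    calc _ ≤ ∑ m ∈ D.ball x with Nat.log 2 ⌊‖D.τ m‖⌋₊ = k, 1 / ((2 : ℝ) ^ k) ^ 2 := by
          apply Finset.sum_le_sum
          intro m hm
          have := (hk m hm).1
          gcongr
      _ = _ := by rw [Finset.sum_const, nsmul_eq_mul]
      _ ≤ (2 * D.A * (2 * 2 ^ k) + 1) ^ 2 * (1 / ((2 : ℝ) ^ k) ^ 2) := by gcongr
      _ ≤ (5 * D.A * 2 ^ k) ^ 2 * (1 / ((2 : ℝ) ^ k) ^ 2) := by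
          gcongr
          nlinarith
      _ = _ := by field_simp; ring
  refine (Finset.sum_le_sum hfib).trans ?_
  rw [Finset.sum_const, Finset.card_range, nsmul_eq_mul, mul_comm]
  gcongr
  push_cast
  have h0 : ⌊√x⌋₊ ≠ 0 := by
    have := (Nat.one_le_floor_iff _).2 hsx
    omega
  have h1 := Nat.pow_log_le_self 2 h0
  rw [← hK] at h1
  have h2 : (2 : ℝ) ^ K ≤ √x := by
    have h3 := Nat.floor_le (Real.sqrt_nonneg x)
    have h4 : ((2 ^ K : ℕ) : ℝ) ≤ (⌊√x⌋₊ : ℝ) := by exact_mod_cast h1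
    push_cast at h4
    linarith
  have h3 := Real.log_le_log (by positivity) h2
  rw [Real.log_pow, Real.log_sqrt (by linarith)] at h3
  have h4 := Real.log_two_gt_d9
  have h5 : (0 : ℝ) ≤ K := by positivity
  nlinarith

lemma prod_primes_dvd_of_nonassoc [IsDomain O] [IsPrincipalIdealRing O] {I : Finset O}
    (hI : ∀ p ∈ I, Prime p) (hne : ∀ p ∈ I, ∀ l ∈ I, p ∣ l → p = l) {m : O}
    (h : ∀ p ∈ I, p ∣ m) : ∏ p ∈ I, p ∣ m := by
  apply Finset.prod_dvd_of_coprime _ h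
  intro p hp l hl hpl
  exact ((hI p hp).irreducible.coprime_iff_not_dvd).2 fun hd => hpl (hne p hp l hl hd)

lemma sum_log_norm_le [IsDomain O] [IsPrincipalIdealRing O] {I : Finset O}
    (hI : ∀ p ∈ I, Prime p) (hne : ∀ p ∈ I, ∀ l ∈ I, p ∣ l → p = l) {m : O} (hm : m ≠ 0)
    (h : ∀ p ∈ I, p ∣ m) : ∑ p ∈ I, Real.log (‖D.τ p‖ ^ 2) ≤ Real.log (‖D.τ m‖ ^ 2) := by
  have hpos : ∀ p ∈ I, 0 < ‖D.τ p‖ ^ 2 := fun p hp => D.norm_sq_pos (hI p hp).ne_zero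
  rw [← Real.log_prod (fun p hp => (hpos p hp).ne'), ← norm_τ_prod]
  apply Real.log_le_log
  · rw [norm_τ_prod]; exact Finset.prod_pos hpos
  · exact D.norm_sq_le_of_dvd (prod_primes_dvd_of_nonassoc hI hne h) hm

lemma log_norm_sq_nonneg {p : O} (hp : p ≠ 0) : 0 ≤ Real.log (‖D.τ p‖ ^ 2) :=
  Real.log_nonneg (D.one_le_norm_sq hp)

lemma log_norm_le_sum_multiplicity [IsDomain O] [IsPrincipalIdealRing O] {P : Finset O}
    (hP : ∀ p ∈ P, Prime p) (m : O) (hm : m ≠ 0) (hs : Smooth P m) :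
    Real.log (‖D.τ m‖ ^ 2) ≤ ∑ p ∈ P, (multiplicity p m : ℝ) * Real.log (‖D.τ p‖ ^ 2) := by
  induction m using UniqueFactorizationMonoid.induction_on_prime with
  | h₁ => exact absurd rfl hm
  | h₂ u hu =>
    have h1 := D.norm_sq_eq_of_associated (associated_one_iff_isUnit.2 hu)
    rw [h1, map_one, norm_one, one_pow, Real.log_one]
    exact Finset.sum_nonneg fun p hp =>
      mul_nonneg (by positivity) (D.log_norm_sq_nonneg (hP p hp).ne_zero)
  | h₃ a l ha hl ih =>
    have h1 := ih ha hs.of_mul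
    obtain ⟨q, hq, hlq⟩ := hs l hl (dvd_mul_right _ _)
    have h2 : Real.log (‖D.τ l‖ ^ 2) ≤
        ∑ p ∈ P, (multiplicity p l : ℝ) * Real.log (‖D.τ p‖ ^ 2) := by
      rw [D.norm_sq_eq_of_associated hlq]
      refine le_trans ?_ (Finset.single_le_sum (f := fun p =>
        (multiplicity p l : ℝ) * Real.log (‖D.τ p‖ ^ 2)) (fun p hp =>
        mul_nonneg (by positivity) (D.log_norm_sq_nonneg (hP p hp).ne_zero)) hq)
      have h3 : (1 : ℝ) ≤ multiplicity q l := by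
        exact_mod_cast multiplicity_pos_of_dvd hlq.symm.dvd
      have h4 := D.log_norm_sq_nonneg (hP q hq).ne_zero
      nlinarith
    rw [norm_sq_mul, Real.log_mul (D.norm_sq_pos hl.ne_zero).ne' (D.norm_sq_pos ha).ne']
    refine (add_le_add h2 h1).trans (le_of_eq ?_)
    rw [← Finset.sum_add_distrib]
    apply Finset.sum_congr rfl
    intro p hp
    rw [multiplicity_mul (hP p hp)
      (FiniteMultiplicity.of_prime_left (hP p hp) (mul_ne_zero hl.ne_zero ha))]
    push_cast
    ring

open Classical in
lemma sum_multiplicity_le [IsDomain O] [IsPrincipalIdealRing O] {P : Finset O} {p : O}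
    (hp : Prime p) (x : ℝ) :
    ∑ m ∈ D.ball x with Smooth P m, (multiplicity p m : ℝ) / ‖D.τ m‖ ^ 2 ≤
      D.Z P x / (‖D.τ p‖ ^ 2 - 1) := by
  set U : ℝ → ℝ := fun x => ∑ m ∈ D.ball x with Smooth P m, (multiplicity p m : ℝ) / ‖D.τ m‖ ^ 2
    with hU
  have hN := D.two_le_of_prime hp
  rcases lt_or_ge x 0 with hx | hx
  · have h1 : D.ball x = ∅ := by
      apply Finset.eq_empty_of_forall_notMem
      intro m hm
      rw [mem_ball] at hm
      linarith [D.one_le_norm_sq hm.1]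
    rw [Z, h1]
    simp
  have hsub := D.ball_mono (D.div_le_self_of_prime hp hx)
  have hUm : U (x / ‖D.τ p‖ ^ 2) ≤ U x := by
    apply Finset.sum_le_sum_of_subset_of_nonneg (Finset.filter_subset_filter _ hsub)
    intros; positivity
  have hZm := D.Z_mono P (D.div_le_self_of_prime hp hx)
  have h1 : U x ≤ 1 / ‖D.τ p‖ ^ 2 * (D.Z P (x / ‖D.τ p‖ ^ 2) + U (x / ‖D.τ p‖ ^ 2)) := by
    calc U x = ∑ m ∈ D.ball x with Smooth P m ∧ p ∣ m, (multiplicity p m : ℝ) / ‖D.τ m‖ ^ 2 := by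
          symm
          apply Finset.sum_subset
          · intro m hm
            rw [Finset.mem_filter] at hm ⊢
            exact ⟨hm.1, hm.2.1⟩
          · intro m hm hm'
            rw [Finset.mem_filter] at hm hm'
            have h2 : ¬ p ∣ m := fun h => hm' ⟨hm.1, hm.2, h⟩
            rw [multiplicity_eq_zero.2 h2]
            simp
      _ = ∑ m ∈ D.ball (x / ‖D.τ p‖ ^ 2) with Smooth P (p * m),
            (multiplicity p (p * m) : ℝ) / ‖D.τ (p * m)‖ ^ 2 :=
          D.sum_ball_dvd hp.ne_zero x (Smooth P) _
      _ ≤ ∑ m ∈ D.ball (x / ‖D.τ p‖ ^ 2) with Smooth P m,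
            (multiplicity p (p * m) : ℝ) / ‖D.τ (p * m)‖ ^ 2 := by
          apply Finset.sum_le_sum_of_subset_of_nonneg
          · intro m hm
            rw [Finset.mem_filter] at hm ⊢
            exact ⟨hm.1, hm.2.of_mul⟩
          · intros; positivity
      _ = 1 / ‖D.τ p‖ ^ 2 * (D.Z P (x / ‖D.τ p‖ ^ 2) + U (x / ‖D.τ p‖ ^ 2)) := by
          rw [hU, Z, ← Finset.sum_add_distrib, Finset.mul_sum]
          apply Finset.sum_congr rfl
          intro m hm
          rw [Finset.mem_filter, mem_ball] at hm
          have hfin := FiniteMultiplicity.of_prime_left hp (mul_ne_zero hp.ne_zero hm.1.1)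
          have hpp : multiplicity p p = 1 := by
            have := FiniteMultiplicity.of_prime_left hp hp.ne_zero
            simp
          rw [multiplicity_mul hp hfin, hpp, norm_sq_mul, Nat.cast_add, Nat.cast_one]
          have h3 := D.norm_sq_pos hp.ne_zero
          have h4 := D.norm_sq_pos hm.1.1
          generalize ‖D.τ p‖ ^ 2 = N at *
          generalize ‖D.τ m‖ ^ 2 = N' at *
          field_simp
  rw [le_div_iff₀ (by linarith)]
  change U x * _ ≤ _
  have h2 := D.norm_sq_pos hp.ne_zero
  generalize ‖D.τ p‖ ^ 2 = N at *
  have h3 : N * U x ≤ D.Z P (x / N) + U (x / N) := by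
    calc _ ≤ N * (1 / N * (D.Z P (x / N) + U (x / N))) := by gcongr
      _ = _ := by field_simp
  linarith

open Classical in
lemma sum_log_smooth_le [IsDomain O] [IsPrincipalIdealRing O] {P : Finset O}
    (hP : ∀ p ∈ P, Prime p) (x : ℝ) :
    ∑ m ∈ D.ball x with Smooth P m, Real.log (‖D.τ m‖ ^ 2) / ‖D.τ m‖ ^ 2 ≤
      D.Z P x * ∑ p ∈ P, Real.log (‖D.τ p‖ ^ 2) / (‖D.τ p‖ ^ 2 - 1) := by
  calc _ ≤ ∑ m ∈ D.ball x with Smooth P m,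
        (∑ p ∈ P, (multiplicity p m : ℝ) * Real.log (‖D.τ p‖ ^ 2)) / ‖D.τ m‖ ^ 2 := by
        apply Finset.sum_le_sum
        intro m hm
        rw [Finset.mem_filter, mem_ball] at hm
        have := D.log_norm_le_sum_multiplicity hP m hm.1.1 hm.2
        gcongr
    _ = ∑ p ∈ P, Real.log (‖D.τ p‖ ^ 2) *
          ∑ m ∈ D.ball x with Smooth P m, (multiplicity p m : ℝ) / ‖D.τ m‖ ^ 2 := by
        simp only [Finset.sum_div, Finset.mul_sum]
        rw [Finset.sum_comm]
        apply Finset.sum_congr rfl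
        intro p _
        apply Finset.sum_congr rfl
        intro m _
        ring
    _ ≤ ∑ p ∈ P, Real.log (‖D.τ p‖ ^ 2) * (D.Z P x / (‖D.τ p‖ ^ 2 - 1)) := by
        apply Finset.sum_le_sum
        intro p hp
        exact mul_le_mul_of_nonneg_left (D.sum_multiplicity_le (hP p hp) x)
          (D.log_norm_sq_nonneg (hP p hp).ne_zero)
    _ = _ := by
        rw [Finset.mul_sum]
        apply Finset.sum_congr rfl
        intro p _
        ring

lemma half_le_log {y : ℝ} (hy : 2 ≤ y) : 1 ≤ 2 * Real.log y := by
  have h1 := Real.log_le_log (by norm_num) hy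
  have h2 := Real.log_two_gt_d9
  linarith

lemma exists_sum_log_prime_le [IsDomain O] [IsPrincipalIdealRing O] : ∃ C : ℝ, 0 < C ∧
    ∀ y : ℝ, 2 ≤ y → ∀ P : Finset O, (∀ p ∈ P, Prime p) → (∀ p ∈ P, ∀ l ∈ P, p ∣ l → p = l) →
      (∀ p ∈ P, ‖D.τ p‖ ^ 2 ≤ y) →
      ∑ p ∈ P, Real.log (‖D.τ p‖ ^ 2) / (‖D.τ p‖ ^ 2 - 1) ≤ C * Real.log y := by
  classical
  obtain ⟨c, hc, hlow⟩ := D.exists_L_lower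
  obtain ⟨C, hC, hup⟩ := D.exists_L_upper
  refine ⟨16 * C / c, by positivity, ?_⟩
  intro y hy P hP hne hPy
  have hly := half_le_log hy
  have hly0 : 0 < Real.log y := by linarith
  have hy2 : (1 : ℝ) ≤ y ^ 2 := one_le_pow₀ (by linarith)
  have h1 : (∑ p ∈ P, Real.log (‖D.τ p‖ ^ 2) / ‖D.τ p‖ ^ 2) * (c * Real.log y) ≤
      Real.log (y ^ 2) * D.L (y ^ 2) := by
    calc _ = ∑ p ∈ P, Real.log (‖D.τ p‖ ^ 2) * (1 / ‖D.τ p‖ ^ 2 * (c * Real.log y)) := by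
          rw [Finset.sum_mul]
          exact Finset.sum_congr rfl fun p _ => by ring
      _ ≤ ∑ p ∈ P, Real.log (‖D.τ p‖ ^ 2) *
            ∑ m ∈ D.ball (y ^ 2) with p ∣ m, 1 / ‖D.τ m‖ ^ 2 := by
          apply Finset.sum_le_sum
          intro p hp
          apply mul_le_mul_of_nonneg_left _ (D.log_norm_sq_nonneg (hP p hp).ne_zero)
          have h2 := D.sum_ball_dvd (hP p hp).ne_zero (y ^ 2) (fun _ => True)
            (fun m => 1 / ‖D.τ m‖ ^ 2)
          simp only [true_and, Finset.filter_true] at h2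
          have hpos := D.norm_sq_pos (hP p hp).ne_zero
          rw [h2]
          simp only [norm_sq_mul, ← one_div_mul_one_div]
          rw [← Finset.mul_sum]
          apply mul_le_mul_of_nonneg_left _ (by positivity)
          refine (hlow y (by linarith)).trans ?_
          apply Finset.sum_le_sum_of_subset_of_nonneg
          · apply D.ball_mono
            rw [le_div_iff₀ hpos]
            have := hPy p hp
            nlinarith
          · intros; positivity
      _ = ∑ m ∈ D.ball (y ^ 2), (1 / ‖D.τ m‖ ^ 2) *
            ∑ p ∈ P with p ∣ m, Real.log (‖D.τ p‖ ^ 2) := by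
          simp only [Finset.sum_filter, Finset.mul_sum]
          rw [Finset.sum_comm]
          apply Finset.sum_congr rfl
          intro m _
          apply Finset.sum_congr rfl
          intro p _
          split_ifs <;> ring
      _ ≤ ∑ m ∈ D.ball (y ^ 2), (1 / ‖D.τ m‖ ^ 2) * Real.log (y ^ 2) := by
          apply Finset.sum_le_sum
          intro m hm
          rw [mem_ball] at hm
          apply mul_le_mul_of_nonneg_left _ (by positivity)
          refine (D.sum_log_norm_le (m := m) ?_ ?_ hm.1 ?_).trans
            (Real.log_le_log (D.norm_sq_pos hm.1) hm.2)
          · intro p hp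
            exact hP p (Finset.mem_filter.1 hp).1
          · intro p hp l hl
            exact hne p (Finset.mem_filter.1 hp).1 l (Finset.mem_filter.1 hl).1
          · intro p hp
            exact (Finset.mem_filter.1 hp).2
      _ = _ := by rw [← Finset.sum_mul, L, mul_comm]
  have h2 : ∑ p ∈ P, Real.log (‖D.τ p‖ ^ 2) / (‖D.τ p‖ ^ 2 - 1) ≤
      2 * ∑ p ∈ P, Real.log (‖D.τ p‖ ^ 2) / ‖D.τ p‖ ^ 2 := by
    rw [Finset.mul_sum]
    apply Finset.sum_le_sum
    intro p hp
    have hN := D.two_le_of_prime (hP p hp)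
    have hl := D.log_norm_sq_nonneg (hP p hp).ne_zero
    rw [div_le_iff₀ (by linarith), mul_div_assoc', div_mul_eq_mul_div, le_div_iff₀ (by linarith)]
    nlinarith
  have h3 := hup (y ^ 2) hy2
  rw [Real.log_pow] at h1 h3
  push_cast at h1 h3
  set S := ∑ p ∈ P, Real.log (‖D.τ p‖ ^ 2) / ‖D.τ p‖ ^ 2
  have h4 : S * c ≤ 2 * D.L (y ^ 2) := by nlinarith
  have h5 : D.L (y ^ 2) ≤ C * (4 * Real.log y) := by
    refine h3.trans ?_
    gcongr
    linarith
  refine h2.trans ?_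
  rw [div_mul_eq_mul_div, le_div_iff₀ hc]
  nlinarith

lemma exists_Z_le_log [IsDomain O] [IsPrincipalIdealRing O] : ∃ C : ℝ, 0 < C ∧
    ∀ y : ℝ, 2 ≤ y → ∀ P : Finset O, (∀ p ∈ P, Prime p) → (∀ p ∈ P, ∀ l ∈ P, p ∣ l → p = l) →
      (∀ p ∈ P, ‖D.τ p‖ ^ 2 ≤ y) → ∀ x, D.Z P x ≤ C * Real.log y := by
  classical
  obtain ⟨C₁, hC₁, h1⟩ := D.exists_sum_log_prime_le
  obtain ⟨C₂, hC₂, h2⟩ := D.exists_L_upper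
  refine ⟨2 * C₂ * (2 + 2 * C₁), by positivity, ?_⟩
  intro y hy P hP hne hPy x
  have hly := half_le_log hy
  have hly0 : 0 < Real.log y := by linarith
  set S := C₁ * Real.log y with hS
  have hS0 : 0 < S := by positivity
  have hZ0 : D.Z P (Real.exp (2 * S)) ≤ C₂ * ((2 + 2 * C₁) * Real.log y) := by
    refine (D.Z_le_L P _).trans ((h2 _ (Real.one_le_exp (by positivity))).trans ?_)
    rw [Real.log_exp]
    gcongr
    nlinarith
  suffices h : D.Z P x ≤ 2 * D.Z P (Real.exp (2 * S)) by linarith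
  rcases le_total x (Real.exp (2 * S)) with hx | hx
  · have h3 := D.Z_mono P hx
    have h4 := D.Z_nonneg P (Real.exp (2 * S))
    linarith
  have h3 : D.Z P x ≤ D.Z P (Real.exp (2 * S)) + D.Z P x / 2 := by
    have h4 := D.sum_log_smooth_le hP x
    have h5 := h1 y hy P hP hne hPy
    calc D.Z P x = ∑ m ∈ D.ball x with Smooth P m, 1 / ‖D.τ m‖ ^ 2 := rfl
      _ ≤ ∑ m ∈ D.ball x with Smooth P m,
          ((if m ∈ D.ball (Real.exp (2 * S)) then 1 / ‖D.τ m‖ ^ 2 else 0) +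
            Real.log (‖D.τ m‖ ^ 2) / ‖D.τ m‖ ^ 2 / (2 * S)) := by
          apply Finset.sum_le_sum
          intro m hm
          rw [Finset.mem_filter, mem_ball] at hm
          have hl := D.log_norm_sq_nonneg hm.1.1
          have hpos := D.norm_sq_pos hm.1.1
          split_ifs with hb
          · have : 0 ≤ Real.log (‖D.τ m‖ ^ 2) / ‖D.τ m‖ ^ 2 / (2 * S) := by positivity
            linarith
          · rw [mem_ball] at hb
            have h6 : Real.exp (2 * S) < ‖D.τ m‖ ^ 2 := by
              by_contra! h6
              exact hb ⟨hm.1.1, h6⟩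
            have h7 := (Real.lt_log_iff_exp_lt hpos).2 h6
            rw [zero_add, div_right_comm]
            gcongr
            rw [le_div_iff₀ (by positivity)]
            linarith
      _ = D.Z P (Real.exp (2 * S)) +
          (∑ m ∈ D.ball x with Smooth P m, Real.log (‖D.τ m‖ ^ 2) / ‖D.τ m‖ ^ 2) / (2 * S) := by
          rw [Finset.sum_add_distrib, Finset.sum_div, ← Finset.sum_filter]
          congr 1
          rw [Z]
          apply Finset.sum_congr _ (fun _ _ => rfl)
          ext m
          simp only [Finset.mem_filter]
          constructor
          · rintro ⟨⟨_, a⟩, b⟩; exact ⟨b, a⟩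
          · rintro ⟨a, b⟩; exact ⟨⟨D.ball_mono hx a, b⟩, a⟩
      _ ≤ _ := by
          refine add_le_add le_rfl ?_
          rw [div_le_div_iff₀ (by positivity) (by norm_num)]
          have h6 := D.Z_nonneg P x
          nlinarith [mul_le_mul_of_nonneg_left h5 h6]
  linarith

lemma exists_primes (z : ℝ) : ∃ P : Finset O, (∀ p ∈ P, Prime p) ∧
    (∀ p ∈ P, ∀ l ∈ P, Associated p l → p = l) ∧ (∀ p ∈ P, ‖D.τ p‖ ^ 2 ≤ z) ∧
    ∀ l, Prime l → ‖D.τ l‖ ^ 2 ≤ z → ∃ p ∈ P, Associated l p := by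
  classical
  refine ⟨((D.ball z).filter Prime).image (fun l => Quot.out (Associates.mk l)), ?_, ?_, ?_, ?_⟩
  · intro p hp
    obtain ⟨l, hl, rfl⟩ := Finset.mem_image.1 hp
    exact (Associates.mk_quot_out l).symm.prime (Finset.mem_filter.1 hl).2
  · intro p hp l hl h
    obtain ⟨p, _, rfl⟩ := Finset.mem_image.1 hp
    obtain ⟨l, _, rfl⟩ := Finset.mem_image.1 hl
    have h1 : Associated p l :=
      ((Associates.mk_quot_out p).symm.trans h).trans (Associates.mk_quot_out l)
    rw [Associates.mk_eq_mk_iff_associated.2 h1]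
  · intro p hp
    obtain ⟨l, hl, rfl⟩ := Finset.mem_image.1 hp
    rw [D.norm_sq_eq_of_associated (Associates.mk_quot_out l)]
    rw [Finset.mem_filter, mem_ball] at hl
    exact hl.1.2
  · intro l hl hz
    refine ⟨_, Finset.mem_image_of_mem _ (Finset.mem_filter.2 ⟨D.mem_ball.2 ⟨hl.ne_zero, hz⟩, hl⟩),
      (Associates.mk_quot_out l).symm⟩

/-- A lower bound for `G` over the primes not dividing a given nonzero element. -/
lemma exists_G_lower [IsDomain O] [IsPrincipalIdealRing O] : ∃ c : ℝ, 0 < c ∧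
    ∀ y z : ℝ, 3 ≤ y → 1 ≤ z → ∀ r : O, r ≠ 0 → ‖D.τ r‖ ^ 2 ≤ Real.exp y →
      ∃ I : Finset O, (∀ p ∈ I, Prime p) ∧ (∀ p ∈ I, ∀ l ∈ I, p ∣ l → p = l) ∧
        (∀ p ∈ I, ‖D.τ p‖ ^ 2 ≤ z) ∧ (∀ p ∈ I, ¬ p ∣ r) ∧
        c * Real.log z ≤ Real.log y * D.G I z := by
  classical
  obtain ⟨c₁, hc₁, hL⟩ := D.exists_L_lower
  obtain ⟨C, hC, hZ⟩ := D.exists_Z_le_log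
  refine ⟨c₁ / (C * Real.exp 2), by positivity, ?_⟩
  intro y z hy hz r hr hry
  have hly : 1 ≤ Real.log y := by
    rw [Real.le_log_iff_exp_le (by linarith)]
    exact Real.exp_one_lt_d9.le.trans (by linarith)
  obtain ⟨P, hP, hassoc, hPz, hrep⟩ := D.exists_primes z
  have hne : ∀ p ∈ P, ∀ l ∈ P, p ∣ l → p = l := fun p hp l hl h =>
    hassoc p hp l hl ((hP p hp).associated_of_dvd (hP l hl) h)
  set I := P.filter (fun p => ¬ p ∣ r) with hI
  set J := P.filter (fun p => p ∣ r ∧ y < ‖D.τ p‖ ^ 2) with hJ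
  set S := P.filter (fun p => p ∣ r ∧ ‖D.τ p‖ ^ 2 ≤ y) with hS
  have hIP : I ⊆ P := Finset.filter_subset _ _
  have hJP : J ⊆ P := Finset.filter_subset _ _
  have hSP : S ⊆ P := Finset.filter_subset _ _
  refine ⟨I, fun p hp => hP p (hIP hp), fun p hp l hl => hne p (hIP hp) l (hIP hl),
    fun p hp => hPz p (hIP hp), fun p hp => (Finset.mem_filter.1 hp).2, ?_⟩
  have hLZ : D.L z ≤ D.Z (I ∪ (J ∪ S)) z := by
    rw [L, Z, Finset.filter_true_of_mem]
    intro m hm l hl hlm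
    rw [mem_ball] at hm
    obtain ⟨p, hp, hlp⟩ := hrep l hl ((D.norm_sq_le_of_dvd hlm hm.1).trans hm.2)
    refine ⟨p, ?_, hlp⟩
    simp only [hI, hJ, hS, Finset.mem_union, Finset.mem_filter, hp, true_and]
    rcases le_or_gt (‖D.τ p‖ ^ 2) y with h | h <;> tauto
  have hZS := hZ y (by linarith) S (fun p hp => hP p (hSP hp))
    (fun p hp l hl => hne p (hSP hp) l (hSP hl)) (fun p hp => (Finset.mem_filter.1 hp).2.2)
  have hprod : ∏ p ∈ J, (‖D.τ p‖ ^ 2 / (‖D.τ p‖ ^ 2 - 1)) ≤ Real.exp 2 := by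
    have hcard : (J.card : ℝ) ≤ y := by
      have h1 := D.sum_log_norm_le (I := J) (fun p hp => hP p (hJP hp))
        (fun p hp l hl => hne p (hJP hp) l (hJP hl)) hr (fun p hp => (Finset.mem_filter.1 hp).2.1)
      have h2 : ∑ p ∈ J, (1 : ℝ) ≤ ∑ p ∈ J, Real.log (‖D.τ p‖ ^ 2) := by
        apply Finset.sum_le_sum
        intro p hp
        exact hly.trans (Real.log_le_log (by linarith) (Finset.mem_filter.1 hp).2.2.le)
      have h3 := Real.log_le_log (D.norm_sq_pos hr) hry
      rw [Real.log_exp] at h3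
      rw [Finset.sum_const, nsmul_eq_mul, mul_one] at h2
      linarith
    have hfac : ∀ p ∈ J, ‖D.τ p‖ ^ 2 / (‖D.τ p‖ ^ 2 - 1) ≤ Real.exp (1 / (y - 1)) := by
      intro p hp
      have h1 := (Finset.mem_filter.1 hp).2.2
      calc ‖D.τ p‖ ^ 2 / (‖D.τ p‖ ^ 2 - 1) = 1 / (‖D.τ p‖ ^ 2 - 1) + 1 := by
            have : ‖D.τ p‖ ^ 2 - 1 ≠ 0 := by linarith
            generalize ‖D.τ p‖ ^ 2 = N at *
            field_simp
            ring
        _ ≤ 1 / (y - 1) + 1 := by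
            gcongr
            linarith
        _ ≤ _ := Real.add_one_le_exp _
    calc _ ≤ ∏ p ∈ J, Real.exp (1 / (y - 1)) := by
          apply Finset.prod_le_prod _ hfac
          intro p hp
          have h1 := (Finset.mem_filter.1 hp).2.2
          apply div_nonneg <;> linarith
      _ = Real.exp (J.card * (1 / (y - 1))) := by rw [Finset.prod_const, Real.exp_nat_mul]
      _ ≤ _ := by
          apply Real.exp_le_exp.2
          rw [mul_one_div, div_le_iff₀ (by linarith)]
          linarith
  have hZJ : ∀ x, D.Z (J ∪ S) x ≤ C * Real.log y * Real.exp 2 := by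
    intro x
    refine (D.Z_union_le_prod S hZS J (fun p hp => hP p (hJP hp)) x).trans ?_
    gcongr
  have hfin := D.Z_union_le_G (J ∪ S) hZJ I (fun p hp => hP p (hIP hp)) z
  have := hL z hz
  rw [div_mul_eq_mul_div, div_le_iff₀ (by positivity)]
  linarith

/-- An upper bound for the number of primes in an arithmetic progression. -/
lemma exists_primes_progression_bound [IsDomain O] [IsPrincipalIdealRing O] :
    ∃ C : ℝ, 0 < C ∧ ∀ y T : ℝ, 3 ≤ y → 1 ≤ T → ∀ r p₁ : O, r ≠ 0 → ‖D.τ r‖ ^ 2 ≤ Real.exp y →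
      ∀ P : Finset O, (∀ p ∈ P, Prime p) → (∀ p ∈ P, ∃ t, p = p₁ + t * r ∧ ‖D.τ t‖ ≤ T) →
        P.card * Real.log T ≤ C * Real.log y * T ^ 2 := by
  classical
  obtain ⟨c, hc, hG⟩ := D.exists_G_lower
  obtain ⟨C, hC, hS⟩ := D.sieve_bound
  have hA := D.one_le_A
  refine ⟨9 * D.A ^ 2 + 4 * C / c, by positivity, ?_⟩
  intro y T hy hT r p₁ hr hry P hP hPt
  have hly : 1 ≤ Real.log y := by
    rw [Real.le_log_iff_exp_le (by linarith)]
    exact Real.exp_one_lt_d9.le.trans (by linarith)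
  have hlT : 0 ≤ Real.log T := Real.log_nonneg hT
  have hlT' : Real.log T ≤ T := (Real.log_le_sub_one_of_pos (by linarith)).trans (by linarith)
  rw [← Finset.card_filter_add_card_filter_not (fun p => ‖D.τ p‖ ^ 2 ≤ T)]
  have h1 : (((P.filter fun p => ‖D.τ p‖ ^ 2 ≤ T).card : ℕ) : ℝ) * Real.log T ≤
      9 * D.A ^ 2 * Real.log y * T ^ 2 := by
    have h2 := D.card_le_of_norm_sub_le (P.filter fun p => ‖D.τ p‖ ^ 2 ≤ T) (√T) 0 (by
      intro p hp
      rw [map_zero, sub_zero]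
      exact Real.le_sqrt_of_sq_le (Finset.mem_filter.1 hp).2)
    have h3 : 1 ≤ √T := Real.one_le_sqrt.2 hT
    have h4 : (2 * D.A * √T + 1) ^ 2 ≤ 9 * D.A ^ 2 * T := by
      calc _ ≤ (3 * D.A * √T) ^ 2 := by gcongr; nlinarith
        _ = 9 * D.A ^ 2 * (√T) ^ 2 := by ring
        _ = _ := by rw [Real.sq_sqrt (by linarith)]
    calc _ ≤ 9 * D.A ^ 2 * T * T := by gcongr; exact h2.trans h4
      _ = 9 * D.A ^ 2 * 1 * T ^ 2 := by ring
      _ ≤ _ := by gcongr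
  have h2 : (((P.filter fun p => ¬ ‖D.τ p‖ ^ 2 ≤ T).card : ℕ) : ℝ) * Real.log T ≤
      4 * C / c * Real.log y * T ^ 2 := by
    obtain ⟨I, hI, hne, hIT, hIr, hIG⟩ := hG y T hy hT r hr hry
    set P₂ := P.filter fun p => ¬ ‖D.τ p‖ ^ 2 ≤ T with hP₂
    choose! t ht using hPt
    have ht' : ∀ p ∈ P₂, p = p₁ + t p * r ∧ ‖D.τ (t p)‖ ≤ T := fun p hp =>
      ht p (Finset.mem_filter.1 hp).1
    have hcard : (P₂.image t).card = P₂.card := by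
      apply Finset.card_image_of_injOn
      intro p hp q hq h
      rw [(ht' p hp).1, (ht' q hq).1, h]
    have h3 := hS T T hT hT I hI hne (P₂.image t) 0 (by
      intro n hn
      obtain ⟨p, hp, rfl⟩ := Finset.mem_image.1 hn
      rw [map_zero, sub_zero]
      exact (ht' p hp).2) (by
      intro l hl
      have hlp := hI l hl
      obtain ⟨u, v, huv⟩ := (hlp.irreducible.coprime_iff_not_dvd).2 (hIr l hl)
      refine ⟨-p₁ * v, ?_⟩
      intro n hn
      obtain ⟨p, hp, rfl⟩ := Finset.mem_image.1 hn
      rintro ⟨d, hd⟩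
      have hlp' : l ∣ p := by
        refine ⟨d * r + p₁ * u, ?_⟩
        conv_lhs => rw [(ht' p hp).1]
        linear_combination r * hd - p₁ * huv
      have h4 := Finset.mem_filter.1 hp
      have h5 := D.norm_sq_eq_of_associated (hlp.associated_of_dvd (hP p h4.1) hlp')
      exact h4.2 (h5 ▸ hIT l hl))
    rw [hcard] at h3
    have hn : (0 : ℝ) ≤ P₂.card := by positivity
    have h4 : (P₂.card : ℝ) * (c * Real.log T) ≤ Real.log y * (C * (T + T) ^ 2) := by
      calc _ ≤ (P₂.card : ℝ) * (Real.log y * D.G I T) := by gcongr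
        _ = Real.log y * (P₂.card * D.G I T) := by ring
        _ ≤ _ := by gcongr
    rw [div_mul_eq_mul_div, div_mul_eq_mul_div, le_div_iff₀ hc]
    linarith
  push_cast
  linarith

lemma exists_dirichlet [IsDomain O] [IsPrincipalIdealRing O] (α : ℂ) (k : ℕ) (hk : 1 ≤ k) :
    ∃ b r : O, r ≠ 0 ∧ IsCoprime b r ∧ ‖D.τ r‖ ≤ k * D.W ∧
      ‖D.τ b - α * D.τ r‖ ≤ 1 / k * D.W := by
  classical
  have hk0 : (0 : ℝ) < k := by exact_mod_cast hk
  have hW := D.one_le_W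
  suffices h : ∃ b r : O, r ≠ 0 ∧ ‖D.τ r‖ ≤ k * D.W ∧ ‖D.τ b - α * D.τ r‖ ≤ 1 / k * D.W by
    obtain ⟨b, r, hr, h1, h2⟩ := h
    obtain ⟨g, hg⟩ := (inferInstance : (Ideal.span {b, r}).IsPrincipal)
    have hg' : Ideal.span {b, r} = Ideal.span {g} := hg
    have hgm : g ∈ Ideal.span {b, r} := by rw [hg']; exact Ideal.mem_span_singleton_self g
    obtain ⟨s, t, hst⟩ := Ideal.mem_span_pair.1 hgm
    obtain ⟨b', rfl⟩ : g ∣ b := by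
      rw [← Ideal.mem_span_singleton, ← hg']
      exact Ideal.subset_span (by simp)
    obtain ⟨r', rfl⟩ : g ∣ r := by
      rw [← Ideal.mem_span_singleton, ← hg']
      exact Ideal.subset_span (by simp)
    have hg0 : g ≠ 0 := left_ne_zero_of_mul hr
    have hr0 : r' ≠ 0 := right_ne_zero_of_mul hr
    have hgn := D.one_le_norm_τ hg0
    refine ⟨b', r', hr0, ⟨s, t, ?_⟩, ?_, ?_⟩
    · apply mul_left_cancel₀ hg0
      linear_combination hst
    · rw [map_mul, norm_mul] at h1
      nlinarith [norm_nonneg (D.τ r')]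
    · have h3 : D.τ (g * b') - α * D.τ (g * r') = D.τ g * (D.τ b' - α * D.τ r') := by
        rw [map_mul, map_mul]; ring
      rw [h3, norm_mul] at h2
      nlinarith [norm_nonneg (D.τ b' - α * D.τ r')]
  choose X Y hXY using D.exists_real_coord
  let z : ℤ × ℤ → ℂ := fun i => α * D.τ ((i.1 : O) + i.2 * D.ω)
  let f : ℤ × ℤ → ℤ × ℤ := fun i =>
    (⌊(k : ℝ) * Int.fract (X (z i))⌋, ⌊(k : ℝ) * Int.fract (Y (z i))⌋)
  have hbox : ∀ x : ℝ, ⌊(k : ℝ) * Int.fract x⌋ ∈ Finset.Ico (0 : ℤ) k := by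
    intro x
    rw [Finset.mem_Ico]
    constructor
    · exact Int.floor_nonneg.2 (mul_nonneg hk0.le (Int.fract_nonneg x))
    · rw [Int.floor_lt]
      push_cast
      nlinarith [Int.fract_lt_one x]
  have hdiff : ∀ x x' : ℝ, ⌊(k : ℝ) * Int.fract x⌋ = ⌊(k : ℝ) * Int.fract x'⌋ →
      |Int.fract x - Int.fract x'| ≤ 1 / k := by
    intro x x' h
    have h1 := Int.abs_sub_lt_one_of_floor_eq_floor h
    rw [← mul_sub, abs_mul, abs_of_pos hk0] at h1
    rw [le_div_iff₀ hk0]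
    linarith
  obtain ⟨⟨u, v⟩, hi, ⟨u', v'⟩, hj, hij, hf⟩ :=
    Finset.exists_ne_map_eq_of_card_lt_of_maps_to
      (s := Finset.Icc (0 : ℤ) k ×ˢ Finset.Icc (0 : ℤ) k)
      (t := Finset.Ico (0 : ℤ) k ×ˢ Finset.Ico (0 : ℤ) k) (f := f)
      (by
        rw [Finset.card_product, Finset.card_product, Int.card_Icc, Int.card_Ico]
        have h1 : ((k : ℤ) + 1 - 0).toNat = k + 1 := by omega
        have h2 : ((k : ℤ) - 0).toNat = k := by omega
        rw [h1, h2]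
        nlinarith)
      (fun i _ => Finset.mem_product.2 ⟨hbox _, hbox _⟩)
  have hf1 := hdiff _ _ (congrArg Prod.fst hf)
  have hf2 := hdiff _ _ (congrArg Prod.snd hf)
  simp only [Finset.mem_product, Finset.mem_Icc] at hi hj
  have hr : (((u - u' : ℤ) : O) + ((v - v' : ℤ) : O) * D.ω) ≠ 0 := by
    intro h0
    have h1 := D.abs_coord_le (u - u') (v - v')
    rw [h0, map_zero, norm_zero, mul_zero] at h1
    have h2 := abs_nonpos_iff.1 h1.1
    have h3 := abs_nonpos_iff.1 h1.2
    rw [Int.cast_eq_zero] at h2 h3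
    exact hij (Prod.ext (by simp only; omega) (by simp only; omega))
  refine ⟨((⌊X (z (u, v))⌋ - ⌊X (z (u', v'))⌋ : ℤ) : O) +
    ((⌊Y (z (u, v))⌋ - ⌊Y (z (u', v'))⌋ : ℤ) : O) * D.ω, _, hr, ?_, ?_⟩
  · rw [τ_coord]
    have h1 : |((u - u' : ℤ) : ℝ)| ≤ k := by
      rw [abs_le]
      constructor
      · have : -(k : ℤ) ≤ u - u' := by omega
        exact_mod_cast this
      · have : u - u' ≤ (k : ℤ) := by omega
        exact_mod_cast this
    have h2 : |((v - v' : ℤ) : ℝ)| ≤ k := by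
      rw [abs_le]
      constructor
      · have : -(k : ℤ) ≤ v - v' := by omega
        exact_mod_cast this
      · have : v - v' ≤ (k : ℤ) := by omega
        exact_mod_cast this
    exact_mod_cast D.norm_coord_le _ _ h1 h2
  · have h1 := D.norm_coord_le _ _ hf1 hf2
    rw [← norm_neg]
    refine le_trans (le_of_eq ?_) h1
    congr 1
    have h2 : α * D.τ (((u - u' : ℤ) : O) + ((v - v' : ℤ) : O) * D.ω) =
        z (u, v) - z (u', v') := by
      simp only [z]
      rw [← mul_sub, ← map_sub]
      congr 2
      push_cast
      ring
    rw [h2, τ_coord]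
    simp only [Int.fract]
    push_cast
    linear_combination hXY (z (u, v)) - hXY (z (u', v'))

lemma card_proportional_le [IsDomain O] [IsPrincipalIdealRing O] {b r : O} (hr : r ≠ 0)
    (hbr : IsCoprime b r) (F : Finset (O × O)) (hF : ∀ i ∈ F, IsCoprime i.1 i.2)
    (h : ∀ i ∈ F, i.1 * r = b * i.2) : (F.card : ℝ) ≤ (2 * D.A + 1) ^ 2 := by
  classical
  have hunit : ∀ i ∈ F, ∃ u : O, i.1 = b * u ∧ i.2 = r * u ∧ ‖D.τ u‖ ≤ 1 := by
    rintro ⟨a, p⟩ hi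
    have h1 : p ∣ r := (hF _ hi).symm.dvd_of_dvd_mul_left ⟨b, by simpa [mul_comm] using h _ hi⟩
    have h2 : r ∣ p := hbr.symm.dvd_of_dvd_mul_left ⟨a, by simpa [mul_comm] using (h _ hi).symm⟩
    obtain ⟨u, hu⟩ := associated_of_dvd_dvd h2 h1
    refine ⟨u, ?_, hu.symm, ?_⟩
    · apply mul_right_cancel₀ hr
      have h3 := h _ hi
      simp only at h3 ⊢
      rw [h3, ← hu]
      ring
    · have h4 := D.norm_sq_eq_of_associated (associated_one_iff_isUnit.2 u.isUnit)
      rw [map_one, norm_one, one_pow] at h4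
      have h5 := norm_nonneg (D.τ (u : O))
      nlinarith
  choose! u hu using hunit
  have h1 := D.card_le_of_norm_sub_le (F.image u) 1 0 (by
    intro n hn
    obtain ⟨i, hi, rfl⟩ := Finset.mem_image.1 hn
    rw [map_zero, sub_zero]
    exact (hu i hi).2.2)
  rw [Finset.card_image_of_injOn] at h1
  · simpa using h1
  · intro i hi j hj hij
    exact Prod.ext (by rw [(hu i hi).1, (hu j hj).1, hij])
      (by rw [(hu i hi).2.1, (hu j hj).2.1, hij])

/-- The number of solutions of `a * r - b * p = s` with `p` prime and `a / p` close to `α`. -/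
lemma exists_fiber_bound [IsDomain O] [IsPrincipalIdealRing O] :
    ∃ C : ℝ, 0 < C ∧ ∀ (y R κ μ : ℝ) (α : ℂ) (b r s : O), 3 ≤ y → 0 < μ →
      1 ≤ 2 / μ → IsCoprime b r → r ≠ 0 → ‖D.τ r‖ ^ 2 ≤ Real.exp y →
      (‖D.τ r‖ = μ * R ∨ ‖D.τ b - α * D.τ r‖ = μ * (κ * R)) → 0 < R → 0 < κ →
      ∀ F : Finset (O × O), (∀ i ∈ F, Prime i.2 ∧ ‖D.τ i.2‖ ≤ R ∧
        ‖D.τ i.1 - α * D.τ i.2‖ ≤ κ * R ∧ i.1 * r - b * i.2 = s) →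
      F.card * Real.log (2 / μ) ≤ C * Real.log y * (2 / μ) ^ 2 := by
  classical
  obtain ⟨C, hC, h⟩ := D.exists_primes_progression_bound
  refine ⟨C, hC, ?_⟩
  intro y R κ μ α b r s hy hμ hT hbr hr hry hmax hR hκ F hF
  rcases F.eq_empty_or_nonempty with rfl | ⟨⟨a₁, p₁⟩, h₁⟩
  · have : 0 ≤ Real.log y := Real.log_nonneg (by linarith)
    simp
    positivity
  have hcard : (F.image Prod.snd).card = F.card := by
    apply Finset.card_image_of_injOn
    rintro ⟨a, p⟩ hi ⟨a', p'⟩ hj hpp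
    simp only at hpp
    subst hpp
    have h2 := (hF _ hi).2.2.2
    have h3 := (hF _ hj).2.2.2
    simp only at h2 h3
    rw [mul_right_cancel₀ hr (by linear_combination h2 - h3 : a * r = a' * r)]
  rw [← hcard]
  apply h y (2 / μ) hy hT r p₁ hr hry
  · intro p hp
    obtain ⟨i, hi, rfl⟩ := Finset.mem_image.1 hp
    exact (hF i hi).1
  · intro p hp
    obtain ⟨⟨a, p⟩, hi, rfl⟩ := Finset.mem_image.1 hp
    obtain ⟨-, h2, h3, h4⟩ := hF _ hi
    obtain ⟨-, h2', h3', h4'⟩ := hF _ h₁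
    simp only at h2 h3 h4 h2' h3' h4' ⊢
    have h5 : r ∣ p - p₁ := by
      apply hbr.symm.dvd_of_dvd_mul_left
      exact ⟨a - a₁, by linear_combination h4' - h4⟩
    obtain ⟨t, ht⟩ := h5
    refine ⟨t, by linear_combination ht, ?_⟩
    have h6 : a - a₁ = b * t := by
      apply mul_right_cancel₀ hr
      linear_combination h4 - h4' + b * ht
    rw [le_div_iff₀ hμ]
    rcases hmax with hm | hm
    · have h7 : ‖D.τ r‖ * ‖D.τ t‖ ≤ 2 * R := by
        rw [← norm_mul, ← map_mul, ← ht, map_sub]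
        exact (norm_sub_le _ _).trans (by linarith)
      rw [hm] at h7
      nlinarith
    · have h7 : ‖D.τ b - α * D.τ r‖ * ‖D.τ t‖ ≤ 2 * (κ * R) := by
        have h8 : (D.τ b - α * D.τ r) * D.τ t =
            (D.τ a - α * D.τ p) - (D.τ a₁ - α * D.τ p₁) := by
          have h9 := congrArg D.τ h6
          have h10 := congrArg D.τ ht
          simp only [map_sub, map_mul] at h9 h10
          linear_combination α * h10 - h9
        rw [← norm_mul, h8]
        exact (norm_sub_le _ _).trans (by linarith)
      rw [hm] at h7
      have : 0 < κ * R := by positivity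
      nlinarith

/-- A Dirichlet approximation, together with the weight `μ` balancing both error terms. -/
lemma exists_balanced_approx [IsDomain O] [IsPrincipalIdealRing O] {Q κ : ℝ} (hQ0 : 0 < Q)
    (hκ : 0 < κ) (hκ1 : κ ≤ 1) (α : ℂ) : ∃ (b r : O) (μ : ℝ), r ≠ 0 ∧ IsCoprime b r ∧ 0 < μ ∧
      ‖D.τ r‖ ≤ μ * √Q ∧ ‖D.τ b - α * D.τ r‖ ≤ μ * (κ * √Q) ∧
      (‖D.τ r‖ = μ * √Q ∨ ‖D.τ b - α * D.τ r‖ = μ * (κ * √Q)) ∧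
      μ ≤ 2 * D.W / √(κ * Q) ∧ ‖D.τ r‖ ^ 2 ≤ 4 * D.W ^ 2 / κ := by
  have hW := D.one_le_W
  set k := ⌈1 / √κ⌉₊ with hk
  have hsκ : 0 < √κ := Real.sqrt_pos.2 hκ
  have hsκ1 : √κ ≤ 1 := Real.sqrt_le_one.2 hκ1
  have hinv : 1 ≤ 1 / √κ := by rw [le_div_iff₀ hsκ]; linarith
  have hk1 : 1 ≤ k := Nat.one_le_ceil_iff.2 (by linarith)
  have hkl : 1 / √κ ≤ k := Nat.le_ceil _
  have hku : (k : ℝ) ≤ 2 * (1 / √κ) := by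
    have := Nat.ceil_lt_add_one (show 0 ≤ 1 / √κ by linarith)
    linarith
  obtain ⟨b, r, hr, hbr, hrk, hbk⟩ := D.exists_dirichlet α k hk1
  have hr1 : ‖D.τ r‖ ≤ 2 * D.W / √κ := by
    refine hrk.trans ?_
    calc (k : ℝ) * D.W ≤ 2 * (1 / √κ) * D.W := by gcongr
      _ = _ := by ring
  have hb1 : ‖D.τ b - α * D.τ r‖ ≤ D.W * √κ := by
    refine hbk.trans ?_
    calc 1 / (k : ℝ) * D.W ≤ √κ * D.W := by
          gcongr
          rw [div_le_iff₀ (by positivity)]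
          rw [div_le_iff₀ hsκ] at hkl
          linarith
      _ = _ := by ring
  set R := √Q with hR
  have hR0 : 0 < R := Real.sqrt_pos.2 hQ0
  have hRsq : R ^ 2 = Q := Real.sq_sqrt hQ0.le
  set μ := max (‖D.τ r‖ / R) (‖D.τ b - α * D.τ r‖ / (κ * R)) with hμ
  have hμ0 : 0 < μ := lt_max_of_lt_left (div_pos (D.norm_τ_pos hr) hR0)
  have hμr : ‖D.τ r‖ ≤ μ * R := by
    rw [← div_le_iff₀ hR0]; exact le_max_left _ _
  have hμb : ‖D.τ b - α * D.τ r‖ ≤ μ * (κ * R) := by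
    rw [← div_le_iff₀ (by positivity)]; exact le_max_right _ _
  have hμeq : ‖D.τ r‖ = μ * R ∨ ‖D.τ b - α * D.τ r‖ = μ * (κ * R) := by
    rcases max_choice (‖D.τ r‖ / R) (‖D.τ b - α * D.τ r‖ / (κ * R)) with h | h
    · left
      rw [hμ, h]
      field_simp
    · right
      rw [hμ, h]
      field_simp
  have hsY : √(κ * Q) = √κ * R := Real.sqrt_mul hκ.le Q
  have hκsq : √κ * √κ = κ := Real.mul_self_sqrt hκ.le
  have hμle : μ ≤ 2 * D.W / √(κ * Q) := by
    rw [hsY]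
    apply max_le
    · rw [div_le_iff₀ hR0]
      refine hr1.trans (le_of_eq ?_)
      field_simp
    · rw [div_le_iff₀ (by positivity)]
      refine hb1.trans ?_
      have : 2 * D.W / (√κ * R) * (κ * R) = 2 * D.W * √κ := by
        calc _ = 2 * D.W / (√κ * R) * ((√κ * √κ) * R) := by rw [hκsq]
          _ = _ := by field_simp
      rw [this]
      have := mul_pos (by linarith : 0 < D.W) hsκ
      linarith
  refine ⟨b, r, μ, hr, hbr, hμ0, hμr, hμb, hμeq, hμle, ?_⟩
  calc _ ≤ (2 * D.W / √κ) ^ 2 := by gcongr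
    _ = 4 * D.W ^ 2 / κ := by rw [div_pow, Real.sq_sqrt hκ.le]; ring

set_option maxHeartbeats 1000000 in
/-- The number of fractions with prime denominators near a given point. -/
lemma exists_fraction_count [IsDomain O] [IsPrincipalIdealRing O] :
    ∃ C Y₀ : ℝ, 0 < C ∧ 1 < Y₀ ∧ ∀ Q κ : ℝ, 16 ≤ Q → 0 < κ → κ ≤ 1 → Y₀ ≤ κ * Q → ∀ α : ℂ,
      ∀ F : Finset (O × O), (∀ i ∈ F, Prime i.2 ∧ IsCoprime i.1 i.2 ∧ ‖D.τ i.2‖ ^ 2 ≤ Q ∧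
        ‖D.τ i.1 - α * D.τ i.2‖ ≤ κ * ‖D.τ i.2‖) →
      F.card * Real.log (κ * Q) ≤ C * (κ * Q) ^ 2 * Real.log (Real.log Q) := by
  classical
  obtain ⟨C, hC, hfib⟩ := D.exists_fiber_bound
  have hW := D.one_le_W
  have hA := D.one_le_A
  have hW4 : 1 ≤ D.W ^ 4 := one_le_pow₀ hW
  refine ⟨(2 * D.A + 1) ^ 2 + 9 * D.A ^ 2 * (16 * (4 * (2 * C))), 16 * D.W ^ 4, by positivity,
    by linarith, ?_⟩
  intro Q κ hQ hκ hκ1 hY α F hF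
  set Y := κ * Q with hYdef
  have hY1 : 1 < Y := by linarith
  have hQ0 : 0 < Q := by linarith
  have hlog2 := Real.log_two_gt_d9
  have hlogQ : 4 * Real.log 2 ≤ Real.log Q := by
    rw [← Nat.cast_ofNat, ← Real.log_pow]
    exact Real.log_le_log (by positivity) (by norm_num; exact hQ)
  have hll : 1 ≤ Real.log (Real.log Q) := by
    rw [Real.le_log_iff_exp_le (by linarith)]
    have := Real.exp_one_lt_d9
    linarith
  have hlY : 0 < Real.log Y := Real.log_pos hY1
  have hlYY : Real.log Y ≤ Y ^ 2 := by
    have := Real.log_le_sub_one_of_pos (by linarith : 0 < Y)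
    nlinarith
  obtain ⟨b, r, μ, hr, hbr, hμ0, hμr, hμb, hμeq, hμle, hrκ⟩ :=
    D.exists_balanced_approx hQ0 hκ hκ1 α
  rw [← hYdef] at hμle
  set R := √Q with hR
  have hR0 : 0 < R := Real.sqrt_pos.2 hQ0
  have hRsq : R ^ 2 = Q := Real.sq_sqrt hQ0.le
  have hsY0 : 0 < √Y := Real.sqrt_pos.2 (by linarith)
  have hsY4 : 4 * D.W ^ 2 ≤ √Y := by
    apply Real.le_sqrt_of_sq_le
    calc (4 * D.W ^ 2) ^ 2 = 16 * D.W ^ 4 := by ring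
      _ ≤ Y := hY
  have hT : √Y / D.W ≤ 2 / μ := by
    rw [div_le_div_iff₀ (by linarith) hμ0]
    rw [le_div_iff₀ hsY0] at hμle
    linarith
  have hT1 : 1 ≤ 2 / μ := by
    refine le_trans ?_ hT
    rw [le_div_iff₀ (by linarith)]
    nlinarith
  have hlT : Real.log Y ≤ 4 * Real.log (2 / μ) := by
    have h1 : Y ≤ (2 / μ) ^ 4 := by
      calc Y = √Y ^ 2 := (Real.sq_sqrt (by linarith)).symm
        _ ≤ √Y ^ 2 * (√Y / D.W ^ 2) ^ 2 := by
          apply le_mul_of_one_le_right (by positivity)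
          apply one_le_pow₀
          rw [le_div_iff₀ (by positivity)]
          nlinarith
        _ = (√Y / D.W) ^ 4 := by field_simp
        _ ≤ _ := by gcongr
    have h2 := Real.log_le_log (by linarith) h1
    rw [Real.log_pow] at h2
    exact_mod_cast h2
  have hry : ‖D.τ r‖ ^ 2 ≤ Real.exp (2 * Real.log Q) := by
    have h1 : Real.exp (2 * Real.log Q) = Q * Q := by
      rw [two_mul, Real.exp_add, Real.exp_log hQ0]
    rw [h1]
    calc _ ≤ 4 * D.W ^ 2 / κ := hrκ
      _ ≤ _ := by
        rw [div_le_iff₀ hκ]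
        have h2 : 4 * D.W ^ 2 ≤ Y := by nlinarith [one_le_pow₀ hW (n := 2)]
        calc 4 * D.W ^ 2 ≤ Y := h2
          _ ≤ Y * Q := le_mul_of_one_le_right (by linarith) (by linarith)
          _ = _ := by rw [hYdef]; ring
  have hly : Real.log (2 * Real.log Q) ≤ 2 * Real.log (Real.log Q) := by
    rw [Real.log_mul (by norm_num) (by linarith)]
    have := Real.log_two_lt_d9
    linarith
  set S := F.image (fun i => i.1 * r - b * i.2) with hS
  have hSn : ∀ s ∈ S, ‖D.τ s‖ ≤ 2 * Y * μ := by
    intro s hs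
    obtain ⟨⟨a, p⟩, hi, rfl⟩ := Finset.mem_image.1 hs
    obtain ⟨-, -, h2, h3⟩ := hF _ hi
    simp only at h2 h3 ⊢
    have h4 : ‖D.τ p‖ ≤ R := Real.le_sqrt_of_sq_le h2
    have h5 : D.τ (a * r - b * p) =
        (D.τ a - α * D.τ p) * D.τ r - (D.τ b - α * D.τ r) * D.τ p := by
      simp only [map_sub, map_mul]; ring
    rw [h5]
    refine (norm_sub_le _ _).trans ?_
    rw [norm_mul, norm_mul]
    calc _ ≤ (κ * R) * (μ * R) + (μ * (κ * R)) * R := by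
          gcongr
          exact h3.trans (by gcongr)
      _ = 2 * (κ * R ^ 2) * μ := by ring
      _ = _ := by rw [hRsq]
  have hF0 : ((F.filter (fun i => i.1 * r - b * i.2 = 0)).card : ℝ) ≤ (2 * D.A + 1) ^ 2 := by
    apply D.card_proportional_le hr hbr
    · intro i hi
      exact (hF i (Finset.mem_filter.1 hi).1).2.1
    · intro i hi
      exact sub_eq_zero.1 (Finset.mem_filter.1 hi).2
  have hfib' : ∀ s, ((F.filter (fun i => i.1 * r - b * i.2 = s)).card : ℝ) * Real.log Y ≤
      4 * (2 * C) * (2 / μ) ^ 2 * Real.log (Real.log Q) := by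
    intro s
    have h1 := hfib (2 * Real.log Q) R κ μ α b r s (by linarith) hμ0 hT1 hbr hr hry hμeq
      hR0 hκ (F.filter (fun i => i.1 * r - b * i.2 = s)) (by
        intro i hi
        obtain ⟨hi, his⟩ := Finset.mem_filter.1 hi
        obtain ⟨h1, -, h2, h3⟩ := hF _ hi
        have h4 : ‖D.τ i.2‖ ≤ R := Real.le_sqrt_of_sq_le h2
        exact ⟨h1, h4, h3.trans (by gcongr), his⟩)
    calc _ ≤ ((F.filter (fun i => i.1 * r - b * i.2 = s)).card : ℝ) *
          (4 * Real.log (2 / μ)) := by gcongr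
      _ = 4 * (((F.filter (fun i => i.1 * r - b * i.2 = s)).card : ℝ) * Real.log (2 / μ)) := by
          ring
      _ ≤ 4 * (C * Real.log (2 * Real.log Q) * (2 / μ) ^ 2) := by gcongr
      _ ≤ 4 * (C * (2 * Real.log (Real.log Q)) * (2 / μ) ^ 2) := by gcongr
      _ = _ := by ring
  have hScard : ((S.erase 0).card : ℝ) ≤ 9 * D.A ^ 2 * (2 * Y * μ) ^ 2 := by
    rcases (S.erase 0).eq_empty_or_nonempty with h0 | ⟨s, hs⟩
    · rw [h0]; simp; positivity
    · obtain ⟨hs0, hs⟩ := Finset.mem_erase.1 hs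
      have h1 : 1 ≤ 2 * Y * μ := (D.one_le_norm_τ hs0).trans (hSn s hs)
      have h2 := D.card_le_of_norm_sub_le (S.erase 0) (2 * Y * μ) 0 (by
        intro n hn
        rw [map_zero, sub_zero]
        exact hSn n (Finset.mem_of_mem_erase hn))
      refine h2.trans ?_
      calc _ ≤ (3 * D.A * (2 * Y * μ)) ^ 2 := by gcongr; nlinarith
        _ = _ := by ring
  have hsplit : (F.card : ℝ) ≤ ((F.filter (fun i => i.1 * r - b * i.2 = 0)).card : ℝ) +
      ∑ s ∈ S.erase 0, ((F.filter (fun i => i.1 * r - b * i.2 = s)).card : ℝ) := by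
    have h1 : F.card = ∑ s ∈ S, (F.filter (fun i => i.1 * r - b * i.2 = s)).card :=
      Finset.card_eq_sum_card_image _ _
    rw [h1]
    by_cases h0 : (0 : O) ∈ S
    · rw [← Finset.add_sum_erase _ _ h0]
      push_cast
      exact le_rfl
    · rw [Finset.erase_eq_of_notMem h0]
      push_cast
      have : (0 : ℝ) ≤ ((F.filter (fun i => i.1 * r - b * i.2 = 0)).card : ℝ) := by positivity
      linarith
  calc (F.card : ℝ) * Real.log Y
      ≤ ((2 * D.A + 1) ^ 2 +
        ∑ s ∈ S.erase 0, ((F.filter (fun i => i.1 * r - b * i.2 = s)).card : ℝ)) * Real.log Y := by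
        gcongr
        linarith
    _ = (2 * D.A + 1) ^ 2 * Real.log Y +
        ∑ s ∈ S.erase 0,
          ((F.filter (fun i => i.1 * r - b * i.2 = s)).card : ℝ) * Real.log Y := by
        rw [add_mul, Finset.sum_mul]
    _ ≤ (2 * D.A + 1) ^ 2 * (Y ^ 2 * Real.log (Real.log Q)) +
        ∑ s ∈ S.erase 0, 4 * (2 * C) * (2 / μ) ^ 2 * Real.log (Real.log Q) := by
        refine add_le_add (mul_le_mul_of_nonneg_left ?_ (by positivity))
          (Finset.sum_le_sum fun s _ => hfib' s)
        exact hlYY.trans (le_mul_of_one_le_right (by positivity) hll)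
    _ ≤ (2 * D.A + 1) ^ 2 * (Y ^ 2 * Real.log (Real.log Q)) +
        9 * D.A ^ 2 * (2 * Y * μ) ^ 2 * (4 * (2 * C) * (2 / μ) ^ 2 * Real.log (Real.log Q)) := by
        rw [Finset.sum_const, nsmul_eq_mul]
        gcongr
    _ = _ := by field_simp; ring

/-- `R` consists of reduced residue systems for the primes of norm at most `Q`. -/
def IsReducedSystem (Q : ℝ) (R : O → Finset O) : Prop :=
  ∀ p : O, Prime p → ‖D.τ p‖ ^ 2 ≤ Q → (∀ r ∈ R p, IsCoprime r p) ∧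
    ∀ s : O, IsCoprime s p → ∃! r : O, r ∈ R p ∧ p ∣ s - r

lemma exists_large_sieve_fractions : ∃ C : ℝ, 0 < C ∧ ∀ Q T κ M : ℝ, 1 ≤ T → 0 < κ → 0 ≤ M →
    (∀ α : ℂ, ∀ F : Finset (O × O), (∀ i ∈ F, Prime i.2 ∧ IsCoprime i.1 i.2 ∧
      ‖D.τ i.2‖ ^ 2 ≤ Q ∧ ‖D.τ i.1 - α * D.τ i.2‖ ≤ κ * ‖D.τ i.2‖) → (F.card : ℝ) ≤ M) →
    ∀ R : O → Finset O, D.IsReducedSystem Q R →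
    ∀ A P : Finset O, (∀ n ∈ A, ‖D.τ n‖ ≤ T) → (∀ p ∈ P, Prime p ∧ ‖D.τ p‖ ^ 2 ≤ Q) →
    ∀ a : O → ℂ, ∑ p ∈ P, ∑ r ∈ R p, ‖∑ n ∈ A, a n * D.ψ (D.τ n * D.τ r / D.τ p)‖ ^ 2 ≤
      C * M * (T + 1 / κ) ^ 2 * ∑ n ∈ A, ‖a n‖ ^ 2 := by
  classical
  obtain ⟨C, hC, h⟩ := D.large_sieve
  refine ⟨C, hC, ?_⟩
  intro Q T κ M hT hκ hM hF R hR A P hA hP a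
  have h1 := h T κ M hT hκ hM (Σ _ : O, O) (P.sigma R) (fun i => D.τ i.2 / D.τ i.1) ?_ A 0
    (fun n hn => by simpa using hA n hn) a
  · rw [Finset.sum_sigma] at h1
    simpa only [mul_div_assoc] using h1
  intro α s' hs' hnear
  choose! o ho using hnear
  have hinj : Set.InjOn (fun i : Σ _ : O, O => (i.2 - o i * i.1, i.1)) s' := by
    rintro ⟨p, r⟩ hi ⟨p', r'⟩ hj hij
    obtain ⟨h2, h3⟩ := Prod.ext_iff.1 hij
    simp only at h2 h3
    subst h3
    obtain ⟨hp, hr⟩ := Finset.mem_sigma.1 (hs' hi)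
    obtain ⟨-, hr'⟩ := Finset.mem_sigma.1 (hs' hj)
    obtain ⟨h4, h5⟩ := hR p (hP p hp).1 (hP p hp).2
    have h6 : r = r' := (h5 r (h4 r hr)).unique ⟨hr, by simp⟩ ⟨hr', _,
      (by linear_combination h2 : r - r' = p * (o ⟨p, r⟩ - o ⟨p, r'⟩))⟩
    rw [h6]
  rw [← Finset.card_image_of_injOn hinj]
  apply hF α
  intro i hi'
  obtain ⟨⟨p, r⟩, hi, rfl⟩ := Finset.mem_image.1 hi'
  obtain ⟨hp, hr⟩ := Finset.mem_sigma.1 (hs' hi)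
  have h2 := ho _ hi
  simp only at h2 hp hr ⊢
  have hp0 := (hP p hp).1.ne_zero
  have hτ := D.τ_ne_zero hp0
  refine ⟨(hP p hp).1, ?_, (hP p hp).2, ?_⟩
  · have h4 := (hR p (hP p hp).1 (hP p hp).2).1 r hr
    rw [sub_eq_add_neg, ← neg_mul]
    exact h4.add_mul_right_left _
  · calc ‖D.τ (r - o ⟨p, r⟩ * p) - α * D.τ p‖
        = ‖(D.τ r / D.τ p - α - D.τ (o ⟨p, r⟩)) * D.τ p‖ := by
          congr 1
          rw [map_sub, map_mul]
          field_simp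
          ring
      _ ≤ _ := by rw [norm_mul]; gcongr

lemma card_fractions_le [IsDomain O] [IsPrincipalIdealRing O] {Q κ : ℝ} (hκ : 0 < κ)
    (hQκ : 2 * κ * Q < 1) (α : ℂ) (F : Finset (O × O))
    (hF : ∀ i ∈ F, Prime i.2 ∧ IsCoprime i.1 i.2 ∧ ‖D.τ i.2‖ ^ 2 ≤ Q ∧
      ‖D.τ i.1 - α * D.τ i.2‖ ≤ κ * ‖D.τ i.2‖) : (F.card : ℝ) ≤ (2 * D.A + 1) ^ 2 := by
  rcases F.eq_empty_or_nonempty with rfl | ⟨j, hj⟩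
  · simp
    positivity
  obtain ⟨h1, h2, h3, h4⟩ := hF j hj
  apply D.card_proportional_le h1.ne_zero h2 F (fun i hi => (hF i hi).2.1)
  intro i hi
  obtain ⟨-, -, h3', h4'⟩ := hF i hi
  by_contra hne
  have h5 := D.one_le_norm_τ (sub_ne_zero.2 hne)
  have h6 : D.τ (i.1 * j.2 - j.1 * i.2) =
      (D.τ i.1 - α * D.τ i.2) * D.τ j.2 - (D.τ j.1 - α * D.τ j.2) * D.τ i.2 := by
    simp only [map_sub, map_mul]
    ring
  rw [h6] at h5
  have h7 := h5.trans (norm_sub_le _ _)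
  rw [norm_mul, norm_mul] at h7
  have h8 := mul_le_mul_of_nonneg_right h4' (norm_nonneg (D.τ j.2))
  have h9 := mul_le_mul_of_nonneg_right h4 (norm_nonneg (D.τ i.2))
  have h10 : ‖D.τ i.2‖ * ‖D.τ j.2‖ ≤ Q := by nlinarith [sq_nonneg (‖D.τ i.2‖ - ‖D.τ j.2‖)]
  have h11 := mul_le_mul_of_nonneg_left h10 hκ.le
  nlinarith

/-- The large sieve inequality for prime moduli. -/
theorem exists_large_sieve_primes [IsDomain O] [IsPrincipalIdealRing O] :
    ∃ C : ℝ, ∀ Q δ N : ℝ, 16 ≤ Q → 0 < δ → δ < 1 → N = Q ^ (1 + δ) / 16 →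
    ∀ R : O → Finset O, D.IsReducedSystem Q R →
    ∀ A P : Finset O, (∀ n ∈ A, ‖D.τ n‖ ^ 2 ≤ N) → (∀ p ∈ P, Prime p ∧ ‖D.τ p‖ ^ 2 ≤ Q) →
    ∀ a : O → ℂ, ∑ p ∈ P, ∑ r ∈ R p, ‖∑ n ∈ A, a n * D.ψ (D.τ n * D.τ r / D.τ p)‖ ^ 2 ≤
      C * (1 / (1 - δ)) * (Q ^ 2 * Real.log (Real.log Q) / Real.log Q) * ∑ n ∈ A, ‖a n‖ ^ 2 := by
  obtain ⟨C₁, Y₀, hC₁, hY₀, hcount⟩ := D.exists_fraction_count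
  obtain ⟨C₂, hC₂, hLS⟩ := D.exists_large_sieve_fractions
  have hA1 := D.one_le_A
  have hlY₀ := Real.log_pos hY₀
  refine ⟨8 * C₁ * C₂ + 32 * C₂ * (2 * D.A + 1) ^ 2 * Real.log Y₀, ?_⟩
  intro Q δ N hQ hδ hδ1 hN R hR A P hA hP a
  have hQ0 : 0 < Q := by linarith
  have hδ' : 0 < 1 - δ := by linarith
  have hlog2 := Real.log_two_gt_d9
  have hl16 : Real.log 16 = 4 * Real.log 2 := by
    rw [← Nat.cast_ofNat (n := 4), ← Real.log_pow]
    norm_num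
  have hlogQ : 4 * Real.log 2 ≤ Real.log Q := by
    rw [← hl16]
    exact Real.log_le_log (by positivity) hQ
  have hlQ0 : 0 < Real.log Q := by linarith
  have hll : 1 ≤ Real.log (Real.log Q) := by
    rw [Real.le_log_iff_exp_le hlQ0]
    have := Real.exp_one_lt_d9
    linarith
  have hN1 : 1 ≤ N := by
    have h1 : Q ^ (1 : ℝ) ≤ Q ^ (1 + δ) :=
      Real.rpow_le_rpow_of_exponent_le (by linarith) (by linarith)
    rw [Real.rpow_one] at h1
    rw [hN]
    linarith
  have hNQ : N ≤ Q ^ 2 := by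
    have h1 : Q ^ (1 + δ) ≤ Q ^ (2 : ℝ) :=
      Real.rpow_le_rpow_of_exponent_le (by linarith) (by linarith)
    rw [Real.rpow_two] at h1
    rw [hN]
    linarith [sq_nonneg Q]
  have hsN1 : 1 ≤ √N := Real.one_le_sqrt.2 hN1
  have hsN0 : 0 < √N := by linarith
  have hsN : √N ^ 2 = N := Real.sq_sqrt (by linarith)
  have hsNQ : √N ≤ Q := Real.sqrt_le_iff.2 ⟨hQ0.le, hNQ⟩
  set κ := 1 / √N with hκ
  have hκ0 : 0 < κ := by positivity
  have hκ1 : κ ≤ 1 := by rw [hκ, div_le_one hsN0]; exact hsN1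
  have hlogY : (1 - δ) * Real.log Q ≤ 2 * Real.log (κ * Q) := by
    have h1 : Real.log N = (1 + δ) * Real.log Q - Real.log 16 := by
      rw [hN, Real.log_div (by positivity) (by norm_num), Real.log_rpow hQ0]
    rw [Real.log_mul hκ0.ne' hQ0.ne', hκ, one_div, Real.log_inv, Real.log_sqrt (by linarith), h1]
    linarith
  have hlY : 0 < Real.log (κ * Q) := by
    have := mul_pos hδ' hlQ0
    linarith
  have hA' : ∀ n ∈ A, ‖D.τ n‖ ≤ √N := fun n hn => Real.le_sqrt_of_sq_le (hA n hn)
  have hS : 0 ≤ ∑ n ∈ A, ‖a n‖ ^ 2 := Finset.sum_nonneg fun _ _ => by positivity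
  set E := Q ^ 2 * Real.log (Real.log Q) / ((1 - δ) * Real.log Q) with hE
  have hE0 : 0 ≤ E := by positivity
  suffices h : ∑ p ∈ P, ∑ r ∈ R p, ‖∑ n ∈ A, a n * D.ψ (D.τ n * D.τ r / D.τ p)‖ ^ 2 ≤
      (8 * C₁ * C₂ + 32 * C₂ * (2 * D.A + 1) ^ 2 * Real.log Y₀) * E * ∑ n ∈ A, ‖a n‖ ^ 2 by
    refine h.trans (le_of_eq ?_)
    rw [hE]
    field_simp
  rcases le_or_gt Y₀ (κ * Q) with hY | hY
  · have h1 := hLS Q (√N) κ (C₁ * (κ * Q) ^ 2 * Real.log (Real.log Q) / Real.log (κ * Q))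
      hsN1 hκ0 (by positivity) (by
        intro α F hF
        rw [le_div_iff₀ hlY]
        exact hcount Q κ hQ hκ0 hκ1 hY α F hF) R hR A P hA' hP a
    refine h1.trans (mul_le_mul_of_nonneg_right ?_ hS)
    calc C₂ * (C₁ * (κ * Q) ^ 2 * Real.log (Real.log Q) / Real.log (κ * Q)) * (√N + 1 / κ) ^ 2
        = 4 * C₁ * C₂ * (Q ^ 2 * Real.log (Real.log Q) / Real.log (κ * Q)) := by
          have h2 : √N + 1 / κ = 2 / κ := by rw [hκ]; field_simp; norm_num
          rw [h2]
          generalize Real.log (κ * Q) = l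
          field_simp
          norm_num
      _ ≤ 4 * C₁ * C₂ * (Q ^ 2 * Real.log (Real.log Q) / ((1 - δ) * Real.log Q / 2)) := by
          gcongr
          linarith
      _ = 8 * C₁ * C₂ * E := by rw [hE]; field_simp; norm_num
      _ ≤ _ := by
          gcongr
          have : 0 ≤ 32 * C₂ * (2 * D.A + 1) ^ 2 * Real.log Y₀ := by positivity
          linarith
  · have hκ' : (0 : ℝ) < 1 / (3 * Q) := by positivity
    have h1 := hLS Q (√N) (1 / (3 * Q)) ((2 * D.A + 1) ^ 2) hsN1 hκ' (by positivity)
      (fun α F hF => D.card_fractions_le hκ' (by field_simp; norm_num) α F hF) R hR A P hA' hP a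
    refine h1.trans (mul_le_mul_of_nonneg_right ?_ hS)
    have h2 : (1 - δ) * Real.log Q ≤ 2 * Real.log Y₀ :=
      hlogY.trans (by have := Real.log_le_log (by positivity) hY.le; linarith)
    have h3 : Q ^ 2 ≤ 2 * Real.log Y₀ * E := by
      rw [hE, mul_div_assoc', le_div_iff₀ (by positivity)]
      have h4 : (1 - δ) * Real.log Q ≤ 2 * Real.log Y₀ * Real.log (Real.log Q) :=
        h2.trans (le_mul_of_one_le_right (by positivity) hll)
      nlinarith [mul_le_mul_of_nonneg_left h4 (sq_nonneg Q)]
    calc C₂ * (2 * D.A + 1) ^ 2 * (√N + 1 / (1 / (3 * Q))) ^ 2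
        ≤ C₂ * (2 * D.A + 1) ^ 2 * (Q + 3 * Q) ^ 2 := by
          rw [one_div_one_div]
          gcongr
      _ = 16 * C₂ * (2 * D.A + 1) ^ 2 * Q ^ 2 := by ring
      _ ≤ 16 * C₂ * (2 * D.A + 1) ^ 2 * (2 * Real.log Y₀ * E) := by gcongr
      _ = 32 * C₂ * (2 * D.A + 1) ^ 2 * Real.log Y₀ * E := by ring
      _ ≤ _ := by
          gcongr
          have : 0 ≤ 8 * C₁ * C₂ := by positivity
          linarith

end LatticeRing

lemma tsum_subtype_eq_sum {α E : Type*} [AddCommMonoid E] [TopologicalSpace E] {p : α → Prop}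
    (h : {x | p x}.Finite) (f : α → E) : ∑' x : {x // p x}, f x.1 = ∑ x ∈ h.toFinset, f x := by
  have : Fintype {x // p x} := h.fintype
  rw [tsum_fintype]
  exact (Finset.sum_subtype _ (fun x => h.mem_toFinset) f).symm

section ImaginaryQuadratic

variable {K : Type} [Field K] [NumberField K]

lemma univ_algHom_eq_pair (hdeg : Module.finrank ℚ K = 2) (σ : K →+* ℂ)
    (himag : ∃ x : K, (σ x).im ≠ 0) [DecidableEq (K →ₐ[ℚ] ℂ)] :
    σ.toRatAlgHom ≠ (ComplexEmbedding.conjugate σ).toRatAlgHom ∧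
    (Finset.univ : Finset (K →ₐ[ℚ] ℂ)) =
      {σ.toRatAlgHom, (ComplexEmbedding.conjugate σ).toRatAlgHom} := by
  have hne : σ.toRatAlgHom ≠ (ComplexEmbedding.conjugate σ).toRatAlgHom := by
    obtain ⟨x, hx⟩ := himag
    intro h
    have h1 : σ x = starRingEnd ℂ (σ x) := DFunLike.congr_fun h x
    exact hx (Complex.conj_eq_iff_im.1 h1.symm)
  refine ⟨hne, (Finset.eq_of_subset_of_card_le (Finset.subset_univ _) ?_).symm⟩
  rw [Finset.card_pair hne, Finset.card_univ, AlgHom.card, hdeg]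

lemma trace_eq_two_mul_re (hdeg : Module.finrank ℚ K = 2) (σ : K →+* ℂ)
    (himag : ∃ x : K, (σ x).im ≠ 0) (x : 𝓞 K) :
    (Algebra.trace ℤ (𝓞 K) x : ℝ) = 2 * (σ x).re := by
  classical
  obtain ⟨hne, huniv⟩ := univ_algHom_eq_pair hdeg σ himag
  have h := trace_eq_sum_embeddings (K := ℚ) (L := K) ℂ (x := (x : K))
  rw [huniv, Finset.sum_pair hne, ← Algebra.coe_trace_int] at h
  have h1 := congrArg Complex.re h
  simpa [two_mul] using h1

lemma norm_eq_norm_sq (hdeg : Module.finrank ℚ K = 2) (σ : K →+* ℂ)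
    (himag : ∃ x : K, (σ x).im ≠ 0) (x : 𝓞 K) :
    (Algebra.norm ℤ x : ℝ) = ‖σ x‖ ^ 2 := by
  classical
  obtain ⟨hne, huniv⟩ := univ_algHom_eq_pair hdeg σ himag
  have h := Algebra.norm_eq_prod_embeddings (K := ℚ) (L := K) ℂ (x : K)
  rw [huniv, Finset.prod_pair hne, ← Algebra.coe_norm_int] at h
  have h2 : ((Algebra.norm ℤ x : ℝ) : ℂ) = σ x * starRingEnd ℂ (σ x) := by
    simpa using h
  rw [Complex.mul_conj, Complex.normSq_eq_norm_sq] at h2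
  exact_mod_cast h2

lemma card_quotient_span_singleton (hdeg : Module.finrank ℚ K = 2) (σ : K →+* ℂ)
    (himag : ∃ x : K, (σ x).im ≠ 0) (x : 𝓞 K) :
    (Nat.card (𝓞 K ⧸ Ideal.span {x}) : ℝ) = ‖σ x‖ ^ 2 := by
  have h := Ideal.absNorm_span_singleton x
  rw [Ideal.absNorm_apply, Submodule.cardQuot_apply] at h
  rw [h, Nat.cast_natAbs, Int.cast_abs, norm_eq_norm_sq hdeg σ himag, abs_of_nonneg (by positivity)]

lemma exists_integral_generator (hdeg : Module.finrank ℚ K = 2) (σ : K →+* ℂ)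
    (himag : ∃ x : K, (σ x).im ≠ 0) : ∃ ω : 𝓞 K, 0 < (σ ω).im ∧
      (∀ n : 𝓞 K, ∃ u v : ℤ, n = u + v * ω) ∧ (-discr K : ℝ) = (2 * (σ ω).im) ^ 2 := by
  have hdisc : (discr K : ℝ) ≠ 0 := Int.cast_ne_zero.2 (discr_ne_zero K)
  have hrank : Module.finrank ℤ (𝓞 K) = 2 := by rw [RingOfIntegers.rank, hdeg]
  let b : Module.Basis (Fin 2) ℤ (𝓞 K) := Module.finBasisOfFinrankEq ℤ (𝓞 K) hrank
  have hrepr (n : 𝓞 K) : ∃ u v : ℤ, n = u * b 0 + v * b 1 :=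
    ⟨b.repr n 0, b.repr n 1, by
      conv_lhs => rw [← b.sum_repr n]
      simp⟩
  obtain ⟨s, t, hst⟩ := hrepr 1
  have hco : IsCoprime s t := by
    rw [← isRelPrime_iff_isCoprime]
    rintro g ⟨s', rfl⟩ ⟨t', rfl⟩
    have hg : IsUnit (algebraMap ℤ (𝓞 K) g) := by
      refine IsUnit.of_mul_eq_one (s' * b 0 + t' * b 1) ?_
      rw [hst]
      push_cast
      simp
      ring
    have h1 := hg.map (Algebra.norm ℤ)
    rw [Algebra.norm_algebraMap, hrank] at h1
    exact (isUnit_pow_iff two_ne_zero).1 h1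
  obtain ⟨p, q, hpq⟩ := hco
  have hpq' : (p : 𝓞 K) * s + q * t = 1 := by exact_mod_cast hpq
  have key : ∀ e : ℤ, e * e = 1 → ∃ ω : 𝓞 K, (σ ω).im = e * (σ (-q * b 0 + p * b 1 : 𝓞 K)).im ∧
      ∀ n : 𝓞 K, ∃ u v : ℤ, n = u + v * ω := by
    intro e he
    have he' : (e : 𝓞 K) * e = 1 := by exact_mod_cast he
    refine ⟨e * (-q * b 0 + p * b 1), by simp, fun n => ?_⟩
    obtain ⟨u, v, rfl⟩ := hrepr n
    refine ⟨u * p + v * q, e * (v * s - u * t), ?_⟩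
    push_cast
    linear_combination (-u * b 0 - v * b 1) * hpq' - (u * p + v * q) * hst
      - (v * s - u * t) * (-q * b 0 + p * b 1) * he'
  have hx : (b 0 : 𝓞 K) = p - t * (-q * b 0 + p * b 1) := by
    linear_combination (-b 0) * hpq' - p * hst
  have hy : (b 1 : 𝓞 K) = q + s * (-q * b 0 + p * b 1) := by
    linear_combination (-b 1) * hpq' - q * hst
  set w : 𝓞 K := -q * b 0 + p * b 1 with hw
  have hd : (-discr K : ℝ) = (2 * (σ w).im) ^ 2 := by
    have h1 : discr K = Algebra.discr ℤ b := (discr_eq_discr K b).symm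
    rw [h1, Algebra.discr_def, Matrix.det_fin_two]
    simp only [Algebra.traceMatrix_apply, Algebra.traceForm_apply]
    push_cast
    simp only [trace_eq_two_mul_re hdeg σ himag]
    have hpq2 : (p : ℝ) * s + q * t = 1 := by exact_mod_cast hpq
    have hx' : σ (b 0) = p - t * σ w := by
      conv_lhs => rw [hx]
      simp
    have hy' : σ (b 1) = q + s * σ w := by
      conv_lhs => rw [hy]
      simp
    simp only [map_mul, hx', hy']
    simp
    linear_combination 4 * (σ w).im ^ 2 * (p * s + q * t + 1) * hpq2
  have hw0 : (σ w).im ≠ 0 := by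
    intro h
    rw [h] at hd
    simp at hd
    exact hdisc (by exact_mod_cast hd)
  rcases hw0.lt_or_gt with h | h
  · obtain ⟨ω, h1, h2⟩ := key (-1) (by norm_num)
    have h3 : (σ ω).im = -(σ w).im := by simpa using h1
    exact ⟨ω, by linarith, h2, by rw [hd, h3]; ring⟩
  · obtain ⟨ω, h1, h2⟩ := key 1 (by norm_num)
    have h3 : (σ ω).im = (σ w).im := by simpa using h1
    exact ⟨ω, by linarith, h2, by rw [hd, h3]⟩

lemma exists_latticeRing (hdeg : Module.finrank ℚ K = 2) (σ : K →+* ℂ)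
    (himag : ∃ x : K, (σ x).im ≠ 0) : ∃ D : LatticeRing (𝓞 K),
      (∀ n : 𝓞 K, D.τ n = σ n) ∧ ∀ z, eK K z = D.ψ z := by
  obtain ⟨ω, h0, hrepr, hd⟩ := exists_integral_generator hdeg σ himag
  refine ⟨⟨σ.comp (algebraMap (𝓞 K) K), ω, h0, hrepr,
    fun x _ => card_quotient_span_singleton hdeg σ himag x⟩, fun _ => rfl, fun z => ?_⟩
  have h1 : √(-discr K : ℝ) = 2 * (σ ω).im := by rw [hd, Real.sqrt_sq (by positivity)]
  have h2 : ((σ ω).im : ℂ) ≠ 0 := by exact_mod_cast h0.ne'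
  simp only [eK, LatticeRing.ψ, h1, ← sub_div, Complex.sub_conj, RingHom.comp_apply]
  congr 2
  push_cast
  field_simp

end ImaginaryQuadratic

/-- the large sieve with prime moduli in an imaginary quadratic number field
K of class number one (K is quadratic with a non-real complex embedding σ and
classNumber K = 1; norms are N(q) = |σ(q)|²).  For Q ≥ 16, 0 < δ < 1, N = Q^{1+δ}/16,
and for each prime modulus p a complete set R p of residues modulo p coprime to p,
Σ_{p prime, N(p) ≤ Q} Σ_{a mod p, (a,p)=1} |Σ_{N(n) ≤ N} a_n ẽ_K(na/p)|²
  ≪ (1/(1-δ)) (Q² log log Q / log Q) Σ_{N(n) ≤ N} |a_n|². -/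
theorem large_sieve_prime_moduli (K : Type) [Field K] [NumberField K]
    (hdeg : Module.finrank ℚ K = 2)
    (σ : K →+* ℂ) (himag : ∃ x : K, (σ x).im ≠ 0)
    (hcl : NumberField.classNumber K = 1) :
    ∃ C : ℝ, ∀ Q δ N : ℝ, 16 ≤ Q → 0 < δ → δ < 1 → N = Q ^ (1 + δ) / 16 →
      ∀ a : 𝓞 K → ℂ, ∀ R : 𝓞 K → Finset (𝓞 K),
      (∀ p : 𝓞 K, Prime p → Complex.normSq (σ (p : K)) ≤ Q →
        (∀ r ∈ R p, IsCoprime r p) ∧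
        (∀ s : 𝓞 K, IsCoprime s p → ∃! r : 𝓞 K, r ∈ R p ∧ p ∣ s - r)) →
      (∑' p : {p : 𝓞 K // Prime p ∧ Complex.normSq (σ (p : K)) ≤ Q},
          ∑ r ∈ R p.1,
            ‖∑' n : {n : 𝓞 K // Complex.normSq (σ (n : K)) ≤ N},
                a n.1 * eK K (σ (n.1 : K) * σ (r : K) / σ (p.1 : K))‖ ^ 2)
      ≤ C * (1 / (1 - δ)) * (Q ^ 2 * Real.log (Real.log Q) / Real.log Q) *
          ∑' n : {n : 𝓞 K // Complex.normSq (σ (n : K)) ≤ N}, ‖a n.1‖ ^ 2 := by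
  obtain ⟨D, hτ, hψ⟩ := exists_latticeRing hdeg σ himag
  have := (classNumber_eq_one_iff (K := K)).1 hcl
  obtain ⟨C, hC⟩ := D.exists_large_sieve_primes
  refine ⟨C, fun Q δ N hQ hδ hδ1 hN a R hR => ?_⟩
  have hnorm (n : 𝓞 K) : Complex.normSq (σ n) = ‖D.τ n‖ ^ 2 := by
    rw [hτ, Complex.normSq_eq_norm_sq]
  have hfin (T : ℝ) : {n : 𝓞 K | Complex.normSq (σ n) ≤ T}.Finite :=
    (D.finite_norm_le √T).subset fun n hn => Real.le_sqrt_of_sq_le ((hnorm n).symm.trans_le hn)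
  have hA := hfin N
  have hP : {p : 𝓞 K | Prime p ∧ Complex.normSq (σ p) ≤ Q}.Finite :=
    (hfin Q).subset fun p hp => hp.2
  have hinner (p r : 𝓞 K) :
      ∑' n : {n : 𝓞 K // Complex.normSq (σ n) ≤ N}, a n.1 * eK K (σ n.1 * σ r / σ p) =
        ∑ n ∈ hA.toFinset, a n * D.ψ (D.τ n * D.τ r / D.τ p) := by
    simp only [hτ, ← hψ]
    exact tsum_subtype_eq_sum hA (fun n => a n * eK K (σ n * σ r / σ p))
  simp only [hinner]
  rw [tsum_subtype_eq_sum hA (fun n => ‖a n‖ ^ 2), tsum_subtype_eq_sum hP (fun p => ∑ r ∈ R p,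
    ‖∑ n ∈ hA.toFinset, a n * D.ψ (D.τ n * D.τ r / D.τ p)‖ ^ 2)]
  simp only [hnorm] at hR
  refine hC Q δ N hQ hδ hδ1 hN R hR _ _ (fun n hn => ?_) (fun p hp => ?_) a
  · exact (hnorm n).symm.trans_le (hA.mem_toFinset.1 hn)
  · exact ⟨(hP.mem_toFinset.1 hp).1, (hnorm p).symm.trans_le (hP.mem_toFinset.1 hp).2⟩
end

section
/- Let R, N ∈ ℕ with N ≥ 2, let x_1, …, x_R ∈ ℝ², let (a_n)_{n ∈ ℤ²} be any double sequence of complex numbers, and let 0 < Δ ≤ 1/2. Set K₀(Δ) = sup_{α ∈ ℝ²} |{r ∈ {1,…,R} : min_{z ∈ ℤ²} ‖x_r − α − z‖₂ ≤ Δ^{1/2}}|. Then Σ_{i=1}^R |Σ_{n ∈ ℤ², ‖n‖₂ ≤ N^{1/2}} a_n · e(n · x_i)|² ≪ K₀(Δ) · (N + Δ^{−1}) · Σ_{n ∈ ℤ², ‖n‖₂ ≤ N^{1/2}} |a_n|². -/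
theorem exists_grid_approx (L : ℕ) (hL : 0 < L) (t : ℝ) :
    ∃ u : ℕ, u < L ∧ ∃ z : ℤ, ∃ δ : ℝ, 0 ≤ δ ∧ δ ≤ 1 / L ∧ t = u / L + δ + z := by
  have hL' : (0 : ℝ) < L := by exact_mod_cast hL
  have h0 : 0 ≤ (L : ℝ) * Int.fract t := by positivity
  refine ⟨⌊L * Int.fract t⌋₊, ?_, ⌊t⌋, Int.fract t - ⌊L * Int.fract t⌋₊ / L, ?_, ?_, ?_⟩
  · rw [Nat.floor_lt h0]
    nlinarith [Int.fract_lt_one t]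
  · rw [sub_nonneg, div_le_iff₀ hL']
    exact (Nat.floor_le h0).trans_eq (mul_comm _ _)
  · rw [sub_le_iff_le_add, ← add_div, le_div_iff₀ hL', mul_comm, add_comm]
    exact (Nat.lt_floor_add_one _).le
  · linarith [Int.fract_add_floor t]

theorem HasSum.mul_of_summable_norm {R ι κ : Type*} [NormedRing R] [CompleteSpace R] {f : ι → R}
    {g : κ → R} {s t : R} (hf : HasSum f s) (hg : HasSum g t) (hf' : Summable fun i => ‖f i‖)
    (hg' : Summable fun i => ‖g i‖) : HasSum (fun p : ι × κ => f p.1 * g p.2) (s * t) :=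
  hf.mul hg (summable_mul_of_summable_norm hf' hg')

theorem NormedSpace.hasSum_exp_mul_exp {𝕂 : Type*} [RCLike 𝕂] (z w : 𝕂) :
    HasSum (fun p : ℕ × ℕ => z ^ p.1 / p.1.factorial * (w ^ p.2 / p.2.factorial))
      (NormedSpace.exp z * NormedSpace.exp w) := by
  have h1 (z : 𝕂) : HasSum (fun p : ℕ => z ^ p / p.factorial) (NormedSpace.exp z) :=
    NormedSpace.expSeries_div_hasSum_exp z
  have h2 (z : 𝕂) : Summable fun p : ℕ => ‖z ^ p / (p.factorial : 𝕂)‖ :=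
    NormedSpace.norm_expSeries_div_summable z
  have := (h1 z).mul_of_summable_norm (h1 w) (h2 z) (h2 w)
  exact this

theorem sum_pow_eq_ite {L : ℕ} {ζ : ℂ} (hζ : IsPrimitiveRoot ζ L) (d : ℤ) :
    ∑ u ∈ Finset.range L, (ζ ^ d) ^ u = if (L : ℤ) ∣ d then (L : ℂ) else 0 := by
  split_ifs with h
  · simp [(hζ.zpow_eq_one_iff_dvd d).2 h]
  · have h1 : ζ ^ d - 1 ≠ 0 := sub_ne_zero.2 fun h' => h ((hζ.zpow_eq_one_iff_dvd d).1 h')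
    have h2 := mul_geom_sum (ζ ^ d) L
    rw [← zpow_natCast, zpow_comm, zpow_natCast, hζ.pow_eq_one, one_zpow, sub_self] at h2
    exact (mul_eq_zero.1 h2).resolve_left h1

theorem sum_grid_norm_sq {ι : Type*} [Fintype ι] {L : ℕ} (hL : L ≠ 0) {ζ : ℂ}
    (hζ : IsPrimitiveRoot ζ L) (n : ι → ℤ × ℤ)
    (hn : ∀ i j, (L : ℤ) ∣ (n i).1 - (n j).1 → (L : ℤ) ∣ (n i).2 - (n j).2 → i = j)
    (b : ι → ℂ) :
    ∑ u ∈ Finset.range L ×ˢ Finset.range L,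
      ‖∑ i, b i * ((ζ ^ (n i).1) ^ u.1 * (ζ ^ (n i).2) ^ u.2)‖ ^ 2
      = (L : ℝ) ^ 2 * ∑ i, ‖b i‖ ^ 2 := by
  classical
  have hc : (starRingEnd ℂ) ζ = ζ⁻¹ := (Complex.inv_eq_conj (hζ.norm'_eq_one hL)).symm
  have h0 : ζ ≠ 0 := hζ.ne_zero hL
  apply Complex.ofReal_injective
  push_cast
  simp_rw [← Complex.mul_conj', map_sum, map_mul, map_pow, map_zpow₀, hc, Finset.sum_mul_sum,
    Finset.mul_sum]
  rw [Finset.sum_comm]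
  refine Finset.sum_congr rfl fun i _ => ?_
  rw [Finset.sum_comm]
  have key (j : ι) : ∑ u ∈ Finset.range L ×ˢ Finset.range L,
      b i * ((ζ ^ (n i).1) ^ u.1 * (ζ ^ (n i).2) ^ u.2) *
        ((starRingEnd ℂ) (b j) * ((ζ⁻¹ ^ (n j).1) ^ u.1 * (ζ⁻¹ ^ (n j).2) ^ u.2))
      = if i = j then (L : ℂ) ^ 2 * (b i * (starRingEnd ℂ) (b i)) else 0 := by
    have : ∀ u : ℕ × ℕ, b i * ((ζ ^ (n i).1) ^ u.1 * (ζ ^ (n i).2) ^ u.2) *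
        ((starRingEnd ℂ) (b j) * ((ζ⁻¹ ^ (n j).1) ^ u.1 * (ζ⁻¹ ^ (n j).2) ^ u.2))
        = b i * (starRingEnd ℂ) (b j) *
          ((ζ ^ ((n i).1 - (n j).1)) ^ u.1 * (ζ ^ ((n i).2 - (n j).2)) ^ u.2) := by
      intro u
      rw [zpow_sub₀ h0, zpow_sub₀ h0, div_eq_mul_inv, div_eq_mul_inv, mul_pow, mul_pow,
        inv_zpow, inv_zpow]
      ring
    simp_rw [this]
    rw [← Finset.mul_sum, Finset.sum_product, ← Finset.sum_mul_sum, sum_pow_eq_ite hζ,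
      sum_pow_eq_ite hζ]
    by_cases hij : i = j
    · subst hij
      simp
      ring
    · rw [if_neg hij]
      by_cases h1 : (L : ℤ) ∣ (n i).1 - (n j).1
      · rw [if_neg fun h2 => hij (hn i j h1 h2)]
        simp
      · simp [h1]
  rw [Finset.sum_congr rfl fun j _ => key j]
  simp

theorem sum_comp_le_mul_sum {ι κ : Type*} [Fintype ι] [DecidableEq κ] (s : Finset κ)
    (u : ι → κ) (hu : ∀ i, u i ∈ s) (K : ℕ) (hK : ∀ v ∈ s, {i | u i = v}.ncard ≤ K)
    (f : κ → ℝ) (hf : ∀ v, 0 ≤ f v) : ∑ i, f (u i) ≤ K * ∑ v ∈ s, f v := by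
  rw [← Finset.sum_fiberwise_of_maps_to (fun i _ => hu i), Finset.mul_sum]
  refine Finset.sum_le_sum fun v hv => ?_
  rw [Finset.sum_congr rfl (g := fun _ => f v) (by simp +contextual), Finset.sum_const,
    nsmul_eq_mul]
  refine mul_le_mul_of_nonneg_right ?_ (hf v)
  have := hK v hv
  rw [Set.ncard_eq_toFinset_card'] at this
  simpa using this

theorem EuclideanSpace.norm_sq_le_of_hasSum {ι κ : Type*} [Fintype ι] {f : κ → ι → ℂ} {g : ι → ℂ}
    {c : κ → ℝ} {B D : ℝ} (hB : 0 ≤ B) (h : ∀ i, HasSum (fun p => f p i) (g i)) (hc : HasSum c D)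
    (hc0 : ∀ p, 0 ≤ c p) (hf : ∀ p, ∑ i, ‖f p i‖ ^ 2 ≤ c p ^ 2 * B) :
    ∑ i, ‖g i‖ ^ 2 ≤ D ^ 2 * B := by
  have hs : HasSum (fun p => WithLp.toLp 2 (f p)) (WithLp.toLp 2 g) :=
    (EuclideanSpace.equiv ι ℂ).symm.toContinuousLinearMap.hasSum (Pi.hasSum.2 h)
  have hb : HasSum (fun p => c p * √B) (D * √B) := hc.mul_right _
  have := hs.norm_le_of_bounded hb fun p => by
    rw [EuclideanSpace.norm_eq]
    refine (Real.sqrt_le_sqrt (hf p)).trans_eq ?_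
    rw [Real.sqrt_mul (sq_nonneg _), Real.sqrt_sq (hc0 p)]
  have h2 := pow_le_pow_left₀ (norm_nonneg _) this 2
  rwa [EuclideanSpace.norm_sq_eq, mul_pow, Real.sq_sqrt hB] at h2

theorem sum_perturbed_grid_le {ι κ : Type*} [Fintype ι] [Fintype κ] {L : ℕ} (hL : L ≠ 0) {ζ : ℂ}
    (hζ : IsPrimitiveRoot ζ L) (n : ι → ℤ × ℤ)
    (hn : ∀ i j, (L : ℤ) ∣ (n i).1 - (n j).1 → (L : ℤ) ∣ (n i).2 - (n j).2 → i = j)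
    (hn1 : ∀ i, |(n i).1| ≤ L) (hn2 : ∀ i, |(n i).2| ≤ L) (a : ι → ℂ)
    (u : κ → ℕ × ℕ) (hu : ∀ k, u k ∈ Finset.range L ×ˢ Finset.range L) (K : ℕ)
    (hK : ∀ v ∈ Finset.range L ×ˢ Finset.range L, {k | u k = v}.ncard ≤ K)
    (δ : κ → ℝ × ℝ) (hδ1 : ∀ k, |(δ k).1| ≤ 1 / L) (hδ2 : ∀ k, |(δ k).2| ≤ 1 / L) :
    ∑ k, ‖∑ i, a i * ((ζ ^ (n i).1) ^ (u k).1 * (ζ ^ (n i).2) ^ (u k).2) *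
        (Complex.exp (2 * Real.pi * Complex.I * (n i).1 * (δ k).1) *
          Complex.exp (2 * Real.pi * Complex.I * (n i).2 * (δ k).2))‖ ^ 2
      ≤ (Real.exp (2 * Real.pi) * Real.exp (2 * Real.pi)) ^ 2 *
        (K * ((L : ℝ) ^ 2 * ∑ i, ‖a i‖ ^ 2)) := by
  have hL' : (0 : ℝ) < L := by positivity
  have hLc : (L : ℂ) ≠ 0 := by exact_mod_cast hL
  have hc := NormedSpace.hasSum_exp_mul_exp (2 * Real.pi) (2 * Real.pi)
  rw [← Real.exp_eq_exp_ℝ] at hc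
  refine EuclideanSpace.norm_sq_le_of_hasSum (by positivity)
    (fun k => hasSum_sum fun i _ => HasSum.mul_left _ ?_) hc (fun p => by positivity)
    (f := fun p k => ∑ i, a i * ((ζ ^ (n i).1) ^ (u k).1 * (ζ ^ (n i).2) ^ (u k).2) *
      ((2 * Real.pi * Complex.I * (n i).1 * (δ k).1) ^ p.1 / p.1.factorial *
        ((2 * Real.pi * Complex.I * (n i).2 * (δ k).2) ^ p.2 / p.2.factorial))) ?_
  · rw [Complex.exp_eq_exp_ℂ]
    exact NormedSpace.hasSum_exp_mul_exp _ _
  rintro ⟨p, q⟩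
  have hcoef {t : ℝ} (ht : |t| ≤ 1 / L) (m : ℕ) :
      ‖(2 * Real.pi * Complex.I * L * t) ^ m / (m.factorial : ℂ)‖
        ≤ (2 * Real.pi) ^ m / m.factorial := by
    rw [norm_div, norm_pow]
    simp only [norm_mul, Complex.norm_I, Complex.norm_natCast, Complex.norm_real,
      Complex.norm_ofNat, Real.norm_eq_abs, mul_one, abs_of_pos Real.pi_pos]
    refine div_le_div_of_nonneg_right (pow_le_pow_left₀ (by positivity) ?_ m) (by positivity)
    rw [mul_assoc (2 * Real.pi)]
    refine mul_le_of_le_one_right (by positivity) ?_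
    rwa [le_div_iff₀' hL'] at ht
  have hratio {m : ℤ} (hm : |m| ≤ L) (r : ℕ) : ‖((m : ℂ) / L) ^ r‖ ≤ 1 := by
    rw [norm_pow, norm_div, Complex.norm_natCast, Complex.norm_intCast]
    refine pow_le_one₀ (by positivity) ((div_le_one hL').2 ?_)
    exact_mod_cast hm
  set b : ι → ℂ := fun i => a i * (((n i).1 / L : ℂ) ^ p * ((n i).2 / L : ℂ) ^ q) with hb
  have hba (i : ι) : ‖b i‖ ≤ ‖a i‖ := by
    rw [hb, norm_mul, norm_mul]
    exact mul_le_of_le_one_right (norm_nonneg _)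
      (mul_le_one₀ (hratio (hn1 i) p) (norm_nonneg _) (hratio (hn2 i) q))
  set F : ℕ × ℕ → ℝ := fun v =>
    ‖∑ i, b i * ((ζ ^ (n i).1) ^ v.1 * (ζ ^ (n i).2) ^ v.2)‖ ^ 2 with hF
  have hterm (k : κ) : ‖∑ i, a i * ((ζ ^ (n i).1) ^ (u k).1 * (ζ ^ (n i).2) ^ (u k).2) *
      ((2 * Real.pi * Complex.I * (n i).1 * (δ k).1) ^ p / p.factorial *
        ((2 * Real.pi * Complex.I * (n i).2 * (δ k).2) ^ q / q.factorial))‖ ^ 2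
      ≤ ((2 * Real.pi) ^ p / p.factorial * ((2 * Real.pi) ^ q / q.factorial)) ^ 2 * F (u k) := by
    have : ∑ i, a i * ((ζ ^ (n i).1) ^ (u k).1 * (ζ ^ (n i).2) ^ (u k).2) *
        ((2 * Real.pi * Complex.I * (n i).1 * (δ k).1) ^ p / p.factorial *
          ((2 * Real.pi * Complex.I * (n i).2 * (δ k).2) ^ q / q.factorial))
        = ((2 * Real.pi * Complex.I * L * (δ k).1) ^ p / p.factorial *
          ((2 * Real.pi * Complex.I * L * (δ k).2) ^ q / q.factorial)) *
          ∑ i, b i * ((ζ ^ (n i).1) ^ (u k).1 * (ζ ^ (n i).2) ^ (u k).2) := by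
      rw [Finset.mul_sum]
      refine Finset.sum_congr rfl fun i _ => ?_
      have hm (m : ℤ) (t : ℝ) : 2 * Real.pi * Complex.I * m * t
          = 2 * Real.pi * Complex.I * L * t * (m / L) := by
        field_simp
      rw [hm, hm (n i).2, mul_pow _ (_ / _), mul_pow _ (_ / _)]
      ring
    rw [this, norm_mul, mul_pow, norm_mul]
    gcongr
    · exact hcoef (hδ1 k) p
    · exact hcoef (hδ2 k) q
  refine (Finset.sum_le_sum fun k _ => hterm k).trans ?_
  rw [← Finset.mul_sum]
  refine mul_le_mul_of_nonneg_left ?_ (sq_nonneg _)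
  refine (sum_comp_le_mul_sum _ u hu K hK F fun v => sq_nonneg _).trans ?_
  rw [hF, sum_grid_norm_sq hL hζ n hn b]
  gcongr with i
  exact hba i


/-- the large sieve for ℝ² with a parameter Δ. If K₀ bounds, uniformly in
α ∈ ℝ², the number of r with min_{z ∈ ℤ²} ‖x_r - α - z‖₂ ≤ Δ^{1/2}, then
Σ_{i=1}^R |Σ_{n ∈ ℤ², ‖n‖₂ ≤ N^{1/2}} a_n e(n·x_i)|² ≪ K₀·(N + Δ⁻¹)·Σ_n |a_n|². -/
theorem large_sieve_R2 :
    ∃ C : ℝ, 0 < C ∧ ∀ (R N : ℕ), 2 ≤ N → ∀ (x : Fin R → ℝ × ℝ)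
      (a : ℤ × ℤ → ℂ) (Δ : ℝ), 0 < Δ → Δ ≤ 1 / 2 → ∀ K₀ : ℕ,
      (∀ α : ℝ × ℝ,
        (Set.ncard {r : Fin R | ∃ z : ℤ × ℤ,
          Real.sqrt (((x r).1 - α.1 - (z.1 : ℝ)) ^ 2 + ((x r).2 - α.2 - (z.2 : ℝ)) ^ 2) ≤
            Real.sqrt Δ}) ≤ K₀) →
      (∑ i : Fin R,
        ‖∑' n : {n : ℤ × ℤ //
              Real.sqrt (((n.1 : ℝ)) ^ 2 + ((n.2 : ℝ)) ^ 2) ≤ Real.sqrt N},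
            a n.1 * Complex.exp (2 * (Real.pi : ℂ) * Complex.I *
              (((n.1.1 : ℝ) * (x i).1 + (n.1.2 : ℝ) * (x i).2 : ℝ) : ℂ))‖ ^ 2)
      ≤ C * K₀ * (N + Δ⁻¹) *
        ∑' n : {n : ℤ × ℤ //
            Real.sqrt (((n.1 : ℝ)) ^ 2 + ((n.2 : ℝ)) ^ 2) ≤ Real.sqrt N}, ‖a n.1‖ ^ 2 := by
  refine ⟨12 * (Real.exp (2 * Real.pi) * Real.exp (2 * Real.pi)) ^ 2, by positivity, ?_⟩
  intro R N hN x a Δ hΔ hΔ' K₀ hK₀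
  obtain ⟨L, hL⟩ : ∃ L : ℕ, L = ⌈2 * √(N : ℝ) + √(2 / Δ)⌉₊ + 1 := ⟨_, rfl⟩
  have hL0 : L ≠ 0 := by omega
  have hLpos : (0 : ℝ) < L := by positivity
  have hL1 : 2 * √(N : ℝ) + √(2 / Δ) < L := by
    rw [hL]
    push_cast
    linarith [Nat.le_ceil (2 * √(N : ℝ) + √(2 / Δ))]
  have hL2 : (L : ℝ) ≤ 2 * √(N : ℝ) + √(2 / Δ) + 2 := by
    rw [hL]
    push_cast
    linarith [Nat.ceil_lt_add_one (show 0 ≤ 2 * √(N : ℝ) + √(2 / Δ) by positivity)]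
  have hsN : √(N : ℝ) ^ 2 = N := Real.sq_sqrt (by positivity)
  have hsΔ : √(2 / Δ) ^ 2 = 2 * Δ⁻¹ := by
    rw [Real.sq_sqrt (by positivity), div_eq_mul_inv]
  have hinv : 2 ≤ Δ⁻¹ := by
    rw [le_inv_comm₀ two_pos hΔ]
    linarith
  have hLsq : (L : ℝ) ^ 2 ≤ 12 * (N + Δ⁻¹) := by
    have := pow_le_pow_left₀ hLpos.le hL2 2
    nlinarith [sq_nonneg (2 * √(N : ℝ) - √(2 / Δ)), sq_nonneg (2 * √(N : ℝ) - 2),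
      sq_nonneg (√(2 / Δ) - 2)]
  have hLΔ : 2 * (1 / (L : ℝ)) ^ 2 ≤ Δ := by
    have h1 : 2 * Δ⁻¹ ≤ (L : ℝ) ^ 2 := by
      rw [← hsΔ]
      gcongr
      linarith [Real.sqrt_nonneg (N : ℝ)]
    rw [div_pow, one_pow, mul_one_div, div_le_iff₀ (by positivity)]
    calc (2 : ℝ) = Δ * (2 * Δ⁻¹) := by field_simp
      _ ≤ Δ * (L : ℝ) ^ 2 := by gcongr
  set ι := {n : ℤ × ℤ // Real.sqrt (((n.1 : ℝ)) ^ 2 + ((n.2 : ℝ)) ^ 2) ≤ Real.sqrt N}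
  have hn1 (n : ι) : 2 * |n.1.1| < L := by
    have h1 : |(n.1.1 : ℝ)| ≤ √(N : ℝ) := (Real.abs_le_sqrt (by nlinarith)).trans n.2
    have h2 : 2 * |(n.1.1 : ℝ)| < L := by linarith [Real.sqrt_nonneg (2 / Δ)]
    exact_mod_cast h2
  have hn2 (n : ι) : 2 * |n.1.2| < L := by
    have h1 : |(n.1.2 : ℝ)| ≤ √(N : ℝ) := (Real.abs_le_sqrt (by nlinarith)).trans n.2
    have h2 : 2 * |(n.1.2 : ℝ)| < L := by linarith [Real.sqrt_nonneg (2 / Δ)]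
    exact_mod_cast h2
  have : Finite ι := by
    refine Set.Finite.subset ((Set.finite_Icc (-(L : ℤ)) L).prod (Set.finite_Icc (-(L : ℤ)) L)) ?_
    intro n hn
    have h1 := hn1 ⟨n, hn⟩
    have h2 := hn2 ⟨n, hn⟩
    simp only [Set.mem_prod, Set.mem_Icc, ← abs_le] at h1 h2 ⊢
    omega
  have := Fintype.ofFinite ι
  have hζ := Complex.isPrimitiveRoot_exp L hL0
  set ζ := Complex.exp (2 * Real.pi * Complex.I / L) with hζdef
  choose u hu z δ hδ0 hδ1 hx using exists_grid_approx L (Nat.pos_of_ne_zero hL0)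
  have hmain := sum_perturbed_grid_le hL0 hζ (fun n : ι => n.1) (fun n m h1 h2 => ?_)
    (fun n => by have := hn1 n; omega) (fun n => by have := hn2 n; omega) (fun n => a n.1)
    (fun i => (u (x i).1, u (x i).2)) (fun i => by simp [hu]) K₀ ?_
    (fun i => (δ (x i).1, δ (x i).2))
    (fun i => by rw [abs_of_nonneg (hδ0 _)]; exact hδ1 _)
    (fun i => by rw [abs_of_nonneg (hδ0 _)]; exact hδ1 _)
  · have hexp (m : ℤ) (t : ℝ) : Complex.exp (2 * Real.pi * Complex.I * (m * t))
        = (ζ ^ m) ^ u t * Complex.exp (2 * Real.pi * Complex.I * m * δ t) := by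
      rw [hζdef, ← Complex.exp_int_mul, ← Complex.exp_nat_mul, ← Complex.exp_add,
        Complex.exp_eq_exp_iff_exists_int]
      refine ⟨m * z t, ?_⟩
      have hLc : (L : ℂ) ≠ 0 := by exact_mod_cast hL0
      have ht : (t : ℂ) = u t / L + δ t + z t := by
        have := congrArg Complex.ofReal (hx t)
        push_cast at this
        exact this
      nth_rewrite 1 [ht]
      push_cast
      field_simp
    rw [tsum_fintype]
    simp_rw [tsum_fintype]
    have hterm (i : Fin R) (n : ι) : a n.1 * Complex.exp (2 * (Real.pi : ℂ) * Complex.I *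
        (((n.1.1 : ℝ) * (x i).1 + (n.1.2 : ℝ) * (x i).2 : ℝ) : ℂ))
        = a n.1 * ((ζ ^ n.1.1) ^ u (x i).1 * (ζ ^ n.1.2) ^ u (x i).2) *
          (Complex.exp (2 * Real.pi * Complex.I * n.1.1 * δ (x i).1) *
            Complex.exp (2 * Real.pi * Complex.I * n.1.2 * δ (x i).2)) := by
      push_cast
      rw [mul_add, Complex.exp_add, hexp, hexp]
      ring
    simp_rw [hterm]
    refine hmain.trans ?_
    calc _ = (Real.exp (2 * Real.pi) * Real.exp (2 * Real.pi)) ^ 2 * K₀ * (L : ℝ) ^ 2 *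
          ∑ n : ι, ‖a n.1‖ ^ 2 := by ring
      _ ≤ (Real.exp (2 * Real.pi) * Real.exp (2 * Real.pi)) ^ 2 * K₀ * (12 * (N + Δ⁻¹)) *
          ∑ n : ι, ‖a n.1‖ ^ 2 := by gcongr
      _ = _ := by ring
  · have eq_of_dvd {p q : ℤ} (hp : 2 * |p| < L) (hq : 2 * |q| < L) (h : (L : ℤ) ∣ p - q) :
        p = q := by
      refine sub_eq_zero.1 (Int.eq_zero_of_abs_lt_dvd h ?_)
      have := abs_sub p q
      omega
    exact Subtype.ext (Prod.ext (eq_of_dvd (hn1 n) (hn1 m) h1) (eq_of_dvd (hn2 n) (hn2 m) h2))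
  · rintro ⟨v, w⟩ -
    refine (Set.ncard_le_ncard ?_ (Set.toFinite _)).trans (hK₀ (v / L, w / L))
    intro i hi
    obtain ⟨hv, hw⟩ := Prod.mk.inj hi
    refine ⟨(z (x i).1, z (x i).2), Real.sqrt_le_sqrt ?_⟩
    have h1 : (x i).1 - v / L - z (x i).1 = δ (x i).1 := by
      rw [← hv]
      linarith [hx (x i).1]
    have h2 : (x i).2 - w / L - z (x i).2 = δ (x i).2 := by
      rw [← hw]
      linarith [hx (x i).2]
    simp only [h1, h2]
    nlinarith [pow_le_pow_left₀ (hδ0 (x i).1) (hδ1 (x i).1) 2,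
      pow_le_pow_left₀ (hδ0 (x i).2) (hδ1 (x i).2) 2]
end
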